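/- The finite sets P_c and P̂_c have the same cardinality: |P_c| = |P̂_c|. -/

import Mathlib

noncomputable section

open scoped RealInnerProductSpace BigOperators Classical
open Filter

namespace AffinePieri

variable {V : Type*} [NormedAddCommGroup V] [InnerProductSpace ℝ V] [FiniteDimensional ℝ V]

/-- The coroot `α^∨ = 2α/⟨α,α⟩` of a vector `α`. -/
def coroot (α : V) : V := (2 / ⟪α, α⟫) • α

lemma refl_involutive (α : V) (k : ℝ) :
    Function.Involutive (fun x : V => x - (⟪x, coroot α⟫ + k) • α) := by
  intro x
  by_cases h : α = 0
  · simp [h, coroot]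
  · have hαα : ⟪α, α⟫ ≠ 0 := fun hc => h (inner_self_eq_zero.mp hc)
    have h2 : ⟪α, coroot α⟫ = 2 := by
      rw [coroot, real_inner_smul_right]
      field_simp
    show (x - (⟪x, coroot α⟫ + k) • α) -
        (⟪x - (⟪x, coroot α⟫ + k) • α, coroot α⟫ + k) • α = x
    rw [inner_sub_left, real_inner_smul_left, h2]
    have key : (⟪x, coroot α⟫ + k) +
        (⟪x, coroot α⟫ - (⟪x, coroot α⟫ + k) * 2 + k) = 0 := by ring
    rw [sub_sub, ← add_smul, key, zero_smul, sub_zero]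

/-- The (affine) orthogonal reflection `x ↦ x - (⟨x,α^∨⟩ + k)α` as a permutation of `V`. -/
def reflP (α : V) (k : ℝ) : Equiv.Perm V :=
  Function.Involutive.toPerm _ (refl_involutive α k)

@[simp] lemma reflP_apply (α : V) (k : ℝ) (x : V) :
    reflP α k x = x - (⟪x, coroot α⟫ + k) • α := rfl

/-- The sign of a real number, as an integer. -/
def zsgn (v : ℝ) : ℤ := if 0 < v then 1 else if v < 0 then -1 else 0

/-- Alternating composition `f ∘ g ∘ f ∘ ⋯` with `m` factors, used for braid relations. -/
def altOp {A : Type*} (f g : A → A) : ℕ → A → A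
  | 0 => id
  | (k + 1) => f ∘ altOp g f k

/-- The interaction potential `v_α` entering the Morse (fusion) potential, for a
parameter family `s`. -/
def vintOf (s : V → ℝ) (α : V) (x : ℝ) : ℝ :=
  (1 - s α ^ 2) * ∫ y in (0:ℝ)..x, 1 / (1 - 2 * s α * Real.cos y + s α ^ 2)

/-- All the standing data of the paper: an irreducible reduced crystallographic root
system `R₀` spanning the Euclidean space `V`, with a positive system, simple roots,
highest (short) roots, an admissible pair `(R₀, R̂₀)` encoded by the map `hat` and the
affine root `α₀`, a `W₀`-invariant multiplicity function `t` with values in `(-1,1)`,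
and an integral level `c > 1`. -/
structure Setup (V : Type*) [NormedAddCommGroup V] [InnerProductSpace ℝ V]
    [FiniteDimensional ℝ V] where
  n : ℕ
  npos : 0 < n
  hdim : Module.finrank ℝ V = n
  R0 : Finset V
  zero_not_mem : (0 : V) ∉ R0
  span_top : Submodule.span ℝ (R0 : Set V) = ⊤
  cryst : ∀ α ∈ R0, ∀ β ∈ R0, ∃ k : ℤ, ⟪β, coroot α⟫ = (k : ℝ)
  refl_mem : ∀ α ∈ R0, ∀ β ∈ R0, β - ⟪β, coroot α⟫ • α ∈ R0
  reduced : ∀ α ∈ R0, ∀ r : ℝ, r • α ∈ R0 → r = 1 ∨ r = -1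
  irred : ¬ ∃ A B : Set V, A.Nonempty ∧ B.Nonempty ∧ A ∪ B = (R0 : Set V) ∧
      ∀ α ∈ A, ∀ β ∈ B, ⟪α, β⟫ = 0
  Rpos : Finset V
  pos_subset : Rpos ⊆ R0
  pos_partition : ∀ α ∈ R0, (α ∈ Rpos ↔ -α ∉ Rpos)
  simple : Fin n → V
  simple_mem : ∀ j, simple j ∈ Rpos
  pos_decomp : ∀ α ∈ Rpos, ∃ f : Fin n → ℕ, α = ∑ j, (f j : ℝ) • simple j
  hroot : V
  hroot_mem : hroot ∈ Rpos
  hroot_highest : ∀ β ∈ R0, ∃ f : Fin n → ℕ, hroot - β = ∑ j, (f j : ℝ) • simple j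
  hs : V
  hs_mem : hs ∈ Rpos
  hs_short : ∀ α ∈ R0, ⟪hs, hs⟫ ≤ ⟪α, α⟫
  hs_highest : ∀ β ∈ R0, ⟪β, β⟫ = ⟪hs, hs⟫ →
      ∃ f : Fin n → ℕ, hs - β = ∑ j, (f j : ℝ) • simple j
  hat : V → V
  a0 : V
  admissible : ((∀ α : V, hat α = coroot α) ∧ a0 = -hs) ∨
      ((∀ α : V, hat α = (2 / ⟪hroot, hroot⟫) • α) ∧ a0 = -hroot)
  t : V → ℝ
  t_bound : ∀ α ∈ R0, |t α| < 1
  t_invariant : ∀ α ∈ R0, ∀ β ∈ R0, t (β - ⟪β, coroot α⟫ • α) = t β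
  c : ℤ
  c_gt : 1 < c

namespace Setup

variable (S : Setup V)

/-- `m_α = 2/⟨α, α̂⟩`. -/
def m (α : V) : ℝ := 2 / ⟪α, S.hat α⟫

/-- The finite Weyl group `W₀`, generated by the reflections in the roots. -/
def W0 : Subgroup (Equiv.Perm V) :=
  Subgroup.closure {w | ∃ α ∈ S.R0, w = reflP α 0}

/-- The affine Weyl group `W`, generated by the affine reflections
`s_a` for `a = α^∨ + m_α r c`. -/
def W : Subgroup (Equiv.Perm V) :=
  Subgroup.closure {w | ∃ α ∈ S.R0, ∃ r : ℤ, w = reflP α (S.m α * (r : ℝ) * (S.c : ℝ))}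

/-- The `W₀`-orbit of a vector. -/
def orb (ω : V) : Set V := {x | ∃ w ∈ S.W0, w ω = x}

/-- The weight lattice `P` of `R₀`. -/
def Plat : Set V := {x | ∀ α ∈ S.R0, ∃ k : ℤ, ⟪x, coroot α⟫ = (k : ℝ)}

/-- The root lattice `Q` of `R₀`. -/
def Qlat : Set V := (AddSubgroup.closure (S.R0 : Set V) : Set V)

/-- The semigroup `Q⁺` generated by the positive roots. -/
def Qplus : Set V := (AddSubmonoid.closure (S.Rpos : Set V) : Set V)

/-- The cone `P⁺` of dominant weights. -/
def Pplus : Set V := {x | x ∈ S.Plat ∧ ∀ α ∈ S.Rpos, 0 ≤ ⟪x, coroot α⟫}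

/-- The dominant affine alcove `A_c = {x | 0 ≤ ⟨x,β⟩ ≤ c ∀ β ∈ R̂₀⁺}`. -/
def Alc : Set V := {x | ∀ α ∈ S.Rpos, 0 ≤ ⟪x, S.hat α⟫ ∧ ⟪x, S.hat α⟫ ≤ (S.c : ℝ)}

/-- `P_c = P ∩ A_c`. -/
def Pc : Set V := {x | x ∈ S.Plat ∧ x ∈ S.Alc}

/-- The weight lattice `P̂` of `R̂₀`. -/
def Phat : Set V := {x | ∀ α ∈ S.R0, ∃ k : ℤ, ⟪x, coroot (S.hat α)⟫ = (k : ℝ)}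

/-- `P̂_c = {μ ∈ P̂ | 0 ≤ ⟨μ,α⟩ ≤ c ∀ α ∈ R₀⁺}`. -/
def Phatc : Set V :=
  {x | x ∈ S.Phat ∧ ∀ α ∈ S.Rpos, 0 ≤ ⟪x, α⟫ ∧ ⟪x, α⟫ ≤ (S.c : ℝ)}

/-- The half sum `ρ` of the positive roots of `R₀`. -/
def rho : V := (2⁻¹ : ℝ) • ∑ α ∈ S.Rpos, α

/-- The half sum `ρ̂` of the positive roots of `R̂₀`. -/
def rhoHat : V := (2⁻¹ : ℝ) • ∑ α ∈ S.Rpos, S.hat α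

/-- The coroot lattice `Q̂^∨` of `R̂₀`. -/
def Qhatvee : Set V :=
  (AddSubgroup.closure ((fun α => coroot (S.hat α)) '' (S.R0 : Set V)) : Set V)

/-- The gradient (direction) of the affine simple root `a_j`:
`α₀` for `j = 0` and `α_j` otherwise. -/
def alpha (j : Fin (S.n + 1)) : V :=
  if h : (j : ℕ) = 0 then S.a0 else S.simple ⟨(j : ℕ) - 1, by have := j.isLt; omega⟩

/-- The constant term of the affine simple root `a_j`. -/
def kconst (j : Fin (S.n + 1)) : ℝ := if (j : ℕ) = 0 then (S.c : ℝ) else 0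

/-- The affine simple root `a_j` as an affine function on `V`. -/
def aFun (j : Fin (S.n + 1)) (x : V) : ℝ := ⟪x, coroot (S.alpha j)⟫ + S.kconst j

/-- The simple affine reflections `s_0, s_1, …, s_n`. -/
def sgen (j : Fin (S.n + 1)) : Equiv.Perm V := reflP (S.alpha j) (S.kconst j)

/-- The length of an element of the affine Weyl group: the minimal length of an
expression as a product of the simple reflections. -/
def len (w : Equiv.Perm V) : ℕ :=
  sInf {k | ∃ l : List (Fin (S.n + 1)), l.length = k ∧ (l.map S.sgen).prod = w}

/-- The length of an element of the finite Weyl group w.r.t. the simple reflections. -/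
def len0 (w : Equiv.Perm V) : ℕ :=
  sInf {k | ∃ l : List (Fin S.n), l.length = k ∧
    (l.map fun j => reflP (S.simple j) 0).prod = w}

/-- `l` is a reduced expression for `w`. -/
def IsReducedWord (l : List (Fin (S.n + 1))) (w : Equiv.Perm V) : Prop :=
  (l.map S.sgen).prod = w ∧ l.length = S.len w

/-- The Bruhat partial order on the affine Weyl group. -/
def BruhatLE (v w : Equiv.Perm V) : Prop :=
  ∃ l : List (Fin (S.n + 1)), S.IsReducedWord l w ∧
    ∃ l' : List (Fin (S.n + 1)), l'.Sublist l ∧ (l'.map S.sgen).prod = v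

/-- Evaluation of a function on the weight lattice at a point of `V` (by `0` off `P`). -/
def ev (f : ↥S.Plat → ℂ) (x : V) : ℂ := if h : x ∈ S.Plat then f ⟨x, h⟩ else 0

/-- The integral part `J_j` of the integral-reflection operators. -/
def Jop (j : Fin (S.n + 1)) (f : ↥S.Plat → ℂ) (x : ↥S.Plat) : ℂ :=
  if 0 < Int.floor (S.aFun j x.1) then
    -∑ k ∈ Finset.Icc (1 : ℤ) (Int.floor (S.aFun j x.1)),
      S.ev f (x.1 - (k : ℝ) • S.alpha j)
  else if Int.floor (S.aFun j x.1) < 0 then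
    ∑ k ∈ Finset.Icc (0 : ℤ) (-(Int.floor (S.aFun j x.1)) - 1),
      S.ev f (x.1 + (k : ℝ) • S.alpha j)
  else 0

/-- The integral-reflection operators `T_j = t_j s_j + (t_j - 1) J_j` on `𝒞(P)`. -/
def Top (j : Fin (S.n + 1)) (f : ↥S.Plat → ℂ) (x : ↥S.Plat) : ℂ :=
  (S.t (S.alpha j) : ℂ) * S.ev f ((S.sgen j)⁻¹ x.1) +
    ((S.t (S.alpha j) : ℂ) - 1) * S.Jop j f x

/-- The operator `T_{j₁} ∘ ⋯ ∘ T_{j_ℓ}` attached to a word `l = [j₁, …, j_ℓ]`. -/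
def wordOp (l : List (Fin (S.n + 1))) : (↥S.Plat → ℂ) → (↥S.Plat → ℂ) :=
  l.foldr (fun j g => S.Top j ∘ g) id

/-- `TW` realizes `w ↦ T_w` (via reduced expressions). -/
def IsTW (TW : Equiv.Perm V → (↥S.Plat → ℂ) → (↥S.Plat → ℂ)) : Prop :=
  ∀ w l, S.IsReducedWord l w → TW w = S.wordOp l

/-- `tw` realizes the length multiplicative function `w ↦ t_w` (via reduced expressions). -/
def IsTmult (tw : Equiv.Perm V → ℂ) : Prop :=
  ∀ w l, S.IsReducedWord l w → tw w = (l.map fun j => (S.t (S.alpha j) : ℂ)).prod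

/-- `wmin` realizes `x ↦ w_x`, the unique shortest affine Weyl group element moving `x`
into the dominant alcove. -/
def IsShortest (wmin : V → Equiv.Perm V) : Prop :=
  ∀ x : V, wmin x ∈ S.W ∧ wmin x x ∈ S.Alc ∧
    ∀ w ∈ S.W, w x ∈ S.Alc →
      S.len (wmin x) ≤ S.len w ∧ (S.len w = S.len (wmin x) → w = wmin x)

/-- The positive affine roots, encoded as pairs `(α, r)` representing `α^∨ + m_α r c`. -/
def RplusP : Set (V × ℤ) :=
  {p | p.1 ∈ S.R0 ∧ (1 ≤ p.2 ∨ (p.2 = 0 ∧ p.1 ∈ S.Rpos))}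

/-- The value of the affine root encoded by `p = (α, r)` at a point of `V`. -/
def affval (p : V × ℤ) (x : V) : ℝ :=
  ⟪x, coroot p.1⟫ + S.m p.1 * (p.2 : ℝ) * (S.c : ℝ)

/-- `R[λ] = {a ∈ R⁺ | a(λ) < 0}`. -/
def Raff (lam : V) : Set (V × ℤ) := {p | p ∈ S.RplusP ∧ S.affval p lam < 0}

/-- `t[λ] = ∏_{a ∈ R[λ]} t_{a'}`. -/
def tBr (lam : V) : ℂ := ∏ᶠ p ∈ S.Raff lam, (S.t p.1 : ℂ)

/-- `θ(λ) = |{a ∈ R⁺ | a(λ) = -2}|`. -/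
def thetaCt (lam : V) : ℕ :=
  Set.ncard {p : V × ℤ | p ∈ S.RplusP ∧ S.affval p lam = -2}

/-- The affine intertwining operator `𝒥`, defined via `wmin` and `TW`. -/
def JJ (wmin : V → Equiv.Perm V) (TW : Equiv.Perm V → (↥S.Plat → ℂ) → (↥S.Plat → ℂ))
    (f : ↥S.Plat → ℂ) (x : ↥S.Plat) : ℂ :=
  (S.tBr x.1)⁻¹ * S.ev (TW (wmin x.1) f) (wmin x.1 x.1)

/-- The Morse (fusion-potential) function `𝒱_μ` for a parameter family `s`. -/
def MorseOf (s : V → ℝ) (μ ξ : V) : ℝ :=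
  ((S.c : ℝ) / 2) * ⟪ξ, ξ⟫ - 2 * Real.pi * ⟪S.rhoHat + μ, ξ⟫ +
    ∑ α ∈ S.Rpos, (2 / ⟪α, coroot (S.hat α)⟫) * ∫ x in (0:ℝ)..(⟪ξ, α⟫), vintOf s α x

/-- The Morse function `𝒱_μ` for the multiplicity function of the setup. -/
def Morse (μ ξ : V) : ℝ := S.MorseOf S.t μ ξ

/-- The critical equation `cξ + ∑_{α∈R₀⁺} v_α(⟨ξ,α⟩) α̂ = 2π(ρ̂ + μ)`. -/
def CritEq (μ x : V) : Prop :=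
  (S.c : ℝ) • x + ∑ α ∈ S.Rpos, (vintOf S.t α ⟪x, α⟫) • S.hat α =
    (2 * Real.pi) • (S.rhoHat + μ)

/-- Extension of a parameter vector indexed by `R₀` to a function on `V` (by zero). -/
def extParam (s : ↥S.R0 → ℝ) : V → ℝ := fun α => if h : α ∈ S.R0 then s ⟨α, h⟩ else 0

/-- `xi` realizes `μ ↦ ξ_μ`, the unique global minimizer of `𝒱_μ`. -/
def IsMinimizer (xi : V → V) : Prop :=
  ∀ μ ∈ S.Phat, ∀ x : V, x ≠ xi μ → S.Morse μ (xi μ) < S.Morse μ x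

/-- The `c`-function of the Macdonald spherical function. -/
def Cfun (ξ : V) : ℂ :=
  ∏ α ∈ S.Rpos, (1 - (S.t α : ℂ) * Complex.exp (-(Complex.I * (⟪ξ, α⟫ : ℂ)))) /
      (1 - Complex.exp (-(Complex.I * (⟪ξ, α⟫ : ℂ))))

/-- The Macdonald spherical function `M_λ(ξ)`. -/
def Msph (lam ξ : V) : ℂ :=
  ∑ᶠ w ∈ (S.W0 : Set (Equiv.Perm V)),
    S.Cfun (w ξ) * Complex.exp (Complex.I * (⟪w ξ, lam⟫ : ℂ))

/-- The orbit sum `m_ω(e^{iξ})`. -/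
def mSym (ω ξ : V) : ℂ := ∑ᶠ ν ∈ S.orb ω, Complex.exp (Complex.I * (⟪ν, ξ⟫ : ℂ))

/-- The plane wave `e^{iξ} ∈ 𝒞(P)`. -/
def planewave (ξ : V) : ↥S.Plat → ℂ :=
  fun lam => Complex.exp (Complex.I * (⟪lam.1, ξ⟫ : ℂ))

/-- The free operator `L_{ω;1}`. -/
def Lfree (ω : V) (f : ↥S.Plat → ℂ) (x : ↥S.Plat) : ℂ :=
  ∑ᶠ ν ∈ S.orb ω, S.ev f (x.1 + ν)

/-- `φ_ξ = ∑_{v ∈ W₀} T_v e^{iξ}`. -/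
def phiW (TW : Equiv.Perm V → (↥S.Plat → ℂ) → (↥S.Plat → ℂ)) (ξ : V) : ↥S.Plat → ℂ :=
  ∑ᶠ w ∈ (S.W0 : Set (Equiv.Perm V)), TW w (S.planewave ξ)

/-- The affine Macdonald spherical function `Φ_ξ = 𝒥 φ_ξ`. -/
def PhiA (wmin : V → Equiv.Perm V)
    (TW : Equiv.Perm V → (↥S.Plat → ℂ) → (↥S.Plat → ℂ)) (ξ : V) : ↥S.Plat → ℂ :=
  S.JJ wmin TW (S.phiW TW ξ)

/-- Invariance of a lattice function under the affine Weyl group. -/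
def Winv (f : ↥S.Plat → ℂ) : Prop :=
  ∀ w ∈ S.W, ∀ x : ↥S.Plat, S.ev f (w⁻¹ x.1) = f x

/-- A minuscule dominant weight. -/
def Minuscule (ω : V) : Prop := ω ∈ S.Pplus ∧ ∀ α ∈ S.Rpos, ⟪ω, coroot α⟫ ≤ 1

/-- `P_ϑ^⋆`: the orbit of the minuscule and quasi-minuscule weights. -/
def Pstar : Set V :=
  {x | ∃ w ∈ S.W0, ∃ η : V, (S.Minuscule η ∨ η = S.hs) ∧ x = w η}

/-- `ê_t(η) = ∏_{β∈R̂₀⁺} t_β^{⟨η,β^∨⟩/2}`. -/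
def et (η : V) : ℂ :=
  ∏ α ∈ S.Rpos, (S.t α : ℂ) ^ (((⟪η, coroot (S.hat α)⟫ / 2 : ℝ) : ℂ))

/-- `ĥ_t = t_{α₀} ê_t(-α₀^∨)`. -/
def hhat : ℂ := (S.t S.a0 : ℂ) * S.et (-(coroot S.a0))

/-- `e_t(ν) = ∏_{α∈R₀⁺} t_α^{⟨ν,α^∨⟩/2}`. -/
def elit (ν : V) : ℂ :=
  ∏ α ∈ S.Rpos, (S.t α : ℂ) ^ (((⟪ν, coroot α⟫ / 2 : ℝ) : ℂ))

/-- `h_t = t_ϑ e_t(-α₀)`. -/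
def hlit : ℂ := (S.t S.hs : ℂ) * S.elit (-S.a0)

/-- The coefficients `d_{λ,ν}`. -/
def dcoef (lam ν : V) : ℂ :=
  if ν ∈ S.orb S.hs then
    (S.thetaCt (lam + ν) : ℂ) * S.elit (-ν) * S.hlit ^ zsgn ⟪lam, S.hat ν⟫
  else 0

/-- The Pieri coefficients `V_{λ,ν}(t)`. -/
def Vcoef (lam ν : V) : ℂ :=
  (∏ α ∈ S.Rpos, if ⟪lam, S.hat α⟫ = 0 ∧ 0 < ⟪ν, S.hat α⟫ then
      (1 - (S.t α : ℂ) * S.et (S.hat α)) / (1 - S.et (S.hat α)) else 1) *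
  ∏ α ∈ S.Rpos, if ⟪lam, S.hat α⟫ = (S.c : ℝ) ∧ ⟪ν, S.hat α⟫ < 0 then
      (1 - (S.t α : ℂ) * S.hhat * S.et (-(S.hat α))) / (1 - S.hhat * S.et (-(S.hat α)))
    else 1

/-- The Pieri coefficients `U_{λ,ω}(t)`. -/
def Ucoef (wmin : V → Equiv.Perm V) (lam ω : V) : ℂ :=
  (∑ᶠ ν ∈ {ν | ν ∈ S.orb ω ∧ wmin (lam + ν) (lam + ν) = lam}, S.tBr (lam + ν)) +
    (1 - (S.t S.hs : ℂ)⁻¹) *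
      ∑ᶠ ν ∈ {ν | ν ∈ S.orb ω ∧ wmin (lam + ν) lam = lam}, S.dcoef lam ν

/-- The linear part of an affine transformation of `V`. -/
def linp (w : Equiv.Perm V) (x : V) : V := w x - w (0 : V)

/-- The set `[x] = {y | y₊ = x₊, w_y ≤ w_x}`. -/
def bra (wmin : V → Equiv.Perm V) (x : V) : Set V :=
  {y | wmin y y = wmin x x ∧ S.BruhatLE (wmin y) (wmin x)}

/-- The partial order `μ ⪯ λ`. -/
def preceq (wmin : V → Equiv.Perm V) (μ lam : V) : Prop :=
  lam - μ ∈ S.Qlat ∧ convexHull ℝ (S.bra wmin μ) ⊆ convexHull ℝ (S.bra wmin lam)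

/-- The Weyl denominator `δ(ξ)`. -/
def weylDenom (ξ : V) : ℂ :=
  ∏ α ∈ S.Rpos, (Complex.exp (Complex.I * (⟪ξ, α⟫ : ℂ) / 2) -
      Complex.exp (-(Complex.I * (⟪ξ, α⟫ : ℂ) / 2)))

/-- The Weyl character `χ_λ(ξ)`. -/
def chiW (lam ξ : V) : ℂ :=
  (S.weylDenom ξ)⁻¹ * ∑ᶠ w ∈ (S.W0 : Set (Equiv.Perm V)),
    ((-1 : ℂ) ^ S.len0 w) * Complex.exp (Complex.I * (⟪w ξ, lam + S.rho⟫ : ℂ))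

/-- The counting function `N_{λ,ω}`. -/
def Ncount (lam ω : V) : ℕ :=
  Nat.card {j : Fin (S.n + 1) // S.aFun j lam = 0 ∧ S.alpha j ∈ S.orb ω}

end Setup


set_option linter.unusedSectionVars false

lemma coroot_inner_self {α : V} (h : α ≠ 0) : ⟪α, coroot α⟫ = 2 := by
  have hαα : ⟪α, α⟫ ≠ 0 := fun hc => h (inner_self_eq_zero.mp hc)
  rw [coroot, real_inner_smul_right]
  field_simp

lemma coroot_ne {α : V} (h : α ≠ 0) : coroot α ≠ 0 := by
  intro h'
  have := coroot_inner_self h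
  rw [h', inner_zero_right] at this
  norm_num at this

lemma coroot_coroot (α : V) : coroot (coroot α) = α := by
  by_cases h : α = 0
  · simp [h, coroot]
  · have hαα : ⟪α, α⟫ ≠ 0 := fun hc => h (inner_self_eq_zero.mp hc)
    have : (2 / ⟪coroot α, coroot α⟫) * (2 / ⟪α, α⟫) = 1 := by
      simp only [coroot, real_inner_smul_left, real_inner_smul_right]
      field_simp
    conv_lhs => rw [coroot]
    rw [show (2 / ⟪coroot α, coroot α⟫) • coroot α
      = ((2 / ⟪coroot α, coroot α⟫) * (2 / ⟪α, α⟫)) • α by rw [mul_smul]; rfl, this, one_smul]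

lemma coroot_neg (α : V) : coroot (-α) = -coroot α := by
  simp [coroot]

lemma coroot_smul {r : ℝ} (α : V) : coroot (r • α) = r⁻¹ • coroot α := by
  by_cases hr : r = 0
  · simp [hr, coroot]
  · by_cases h : α = 0
    · simp [h, coroot]
    · have hαα : ⟪α, α⟫ ≠ 0 := fun hc => h (inner_self_eq_zero.mp hc)
      simp only [coroot, real_inner_smul_left, real_inner_smul_right, smul_smul]
      congr 1
      field_simp

lemma inner_coroot_pos {α β : V} (h : 0 < ⟪β, α⟫) : 0 < ⟪β, coroot α⟫ := by
  have h0 : α ≠ 0 := by rintro rfl; simp at h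
  have : 0 < ⟪α, α⟫ := real_inner_self_pos.mpr h0
  rw [coroot, real_inner_smul_right]
  positivity

/-- Root system data with a highest root and a level. -/
structure RSys (V : Type*) [NormedAddCommGroup V] [InnerProductSpace ℝ V]
    [FiniteDimensional ℝ V] where
  n : ℕ
  R : Finset V
  Rp : Finset V
  b : Module.Basis (Fin n) ℝ V
  hi : V
  zero_not_mem : (0 : V) ∉ R
  span_top : Submodule.span ℝ (R : Set V) = ⊤
  cryst : ∀ α ∈ R, ∀ β ∈ R, ∃ k : ℤ, ⟪β, coroot α⟫ = (k : ℝ)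
  refl_mem : ∀ α ∈ R, ∀ β ∈ R, β - ⟪β, coroot α⟫ • α ∈ R
  reduced : ∀ α ∈ R, ∀ r : ℝ, r • α ∈ R → r = 1 ∨ r = -1
  pos_sub : ∀ α ∈ Rp, α ∈ R
  pos_or : ∀ α ∈ R, α ∈ Rp ∨ -α ∈ Rp
  simple_mem : ∀ j, b j ∈ Rp
  pos_nonneg : ∀ α ∈ Rp, ∀ j, 0 ≤ b.repr α j
  hi_mem : hi ∈ Rp
  hi_nonneg : ∀ β ∈ R, ∀ j, 0 ≤ b.repr (hi - β) j
  c : ℤ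
  c_pos : 0 < c

namespace RSys

variable (T : RSys V)

lemma ne_zero {α : V} (h : α ∈ T.R) : α ≠ 0 := fun h' => T.zero_not_mem (h' ▸ h)

lemma neg_mem {α : V} (h : α ∈ T.R) : -α ∈ T.R := by
  have := T.refl_mem α h α h
  rw [coroot_inner_self (T.ne_zero h), two_smul] at this
  simpa using this

/-- Affine roots. -/
def Phi : Set (V × ℝ) := {a | a.1 ∈ T.R ∧ ∃ k : ℤ, a.2 = k}

/-- Value of an affine root. -/
def val (a : V × ℝ) (x : V) : ℝ := ⟪x, a.1⟫ + a.2 * T.c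

/-- Affine reflection. -/
def s (a : V × ℝ) (x : V) : V := x - T.val a x • coroot a.1

/-- Reflection of affine roots. -/
def rr (a b : V × ℝ) : V × ℝ := b - ⟪b.1, coroot a.1⟫ • a

/-- Simple affine roots. -/
def sr : Option (Fin T.n) → V × ℝ
  | none => (-T.hi, 1)
  | some j => (T.b j, 0)

/-- Coordinates of affine roots. -/
def crd (a : V × ℝ) : Option (Fin T.n) → ℝ
  | none => a.2
  | some j => T.b.repr (a.1 + a.2 • T.hi) j

lemma crd_sub (a b : V × ℝ) (r : ℝ) (i) : T.crd (a - r • b) i = T.crd a i - r * T.crd b i := by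
  cases i with
  | none => simp [crd]
  | some j =>
    simp only [crd]
    rw [show (a - r • b).1 + (a - r • b).2 • T.hi = (a.1 + a.2 • T.hi) - r • (b.1 + b.2 • T.hi) by
      simp only [Prod.fst_sub, Prod.snd_sub, Prod.smul_fst, Prod.smul_snd, smul_eq_mul]; module]
    rw [map_sub, map_smul]
    rfl

lemma crd_neg (a : V × ℝ) (i) : T.crd (-a) i = - T.crd a i := by
  have := T.crd_sub 0 a 1 i
  have h0 : T.crd 0 i = 0 := by cases i <;> simp [crd]
  simpa [h0] using this

lemma crd_sr (i k) : T.crd (T.sr i) k = if i = k then 1 else 0 := by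
  cases i <;> cases k <;> simp [crd, sr, Finsupp.single_apply]

lemma expand (a : V × ℝ) : a = ∑ i, T.crd a i • T.sr i := by
  rw [Fintype.sum_option]
  have h := T.b.sum_repr (a.1 + a.2 • T.hi)
  have : ∑ i, T.crd a (some i) • T.sr (some i) = (a.1 + a.2 • T.hi, 0) := by
    rw [← h]
    ext
    · simp [crd, sr, Prod.fst_sum]
    · simp [crd, sr, Prod.snd_sum]
  rw [this]
  ext <;> simp [crd, sr]

lemma crd_ext {a b : V × ℝ} (h : ∀ i, T.crd a i = T.crd b i) : a = b := by
  rw [T.expand a, T.expand b]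
  simp [h]

lemma val_expand (a : V × ℝ) (x : V) : T.val a x = ∑ i, T.crd a i * T.val (T.sr i) x := by
  have h1 : ∀ (ι : Type) (t : Finset ι) (f : ι → ℝ) (g : ι → V × ℝ),
      T.val (∑ i ∈ t, f i • g i) x = ∑ i ∈ t, f i * T.val (g i) x := by
    intro ι t f g
    simp only [val, Prod.fst_sum, Prod.snd_sum, inner_sum, Finset.sum_mul, Prod.smul_fst,
      Prod.smul_snd, real_inner_smul_right, smul_eq_mul, ← Finset.sum_add_distrib]
    exact Finset.sum_congr rfl fun i _ => by ring
  conv_lhs => rw [T.expand a]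
  exact h1 _ _ _ _

/-- Positivity. -/
def Pos (a : V × ℝ) : Prop := ∀ i, 0 ≤ T.crd a i

lemma pos_iff_aux {β : V} (hβ : β ∈ T.R) {k : ℤ} (hk : 1 ≤ k) : T.Pos (β, (k:ℝ)) := by
  have hk' : (1:ℝ) ≤ k := by exact_mod_cast hk
  intro i
  cases i with
  | none => simp only [crd]; linarith
  | some j =>
    simp only [crd]
    have h1 := T.hi_nonneg _ (T.neg_mem hβ) j
    have h2 := T.pos_nonneg _ T.hi_mem j
    rw [show β + (k:ℝ) • T.hi = (T.hi - -β) + ((k:ℝ) - 1) • T.hi by module]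
    rw [map_add, map_smul]
    simp only [Finsupp.add_apply, Finsupp.smul_apply, smul_eq_mul]
    have := mul_nonneg (sub_nonneg.2 hk') h2
    linarith

lemma pos_zero {β : V} (hβ : β ∈ T.Rp) : T.Pos (β, 0) := by
  intro i
  cases i with
  | none => simp [crd]
  | some j => simpa [crd] using T.pos_nonneg _ hβ j

lemma pos_or_neg {a : V × ℝ} (ha : a ∈ T.Phi) : T.Pos a ∨ T.Pos (-a) := by
  obtain ⟨β, r⟩ := a
  obtain ⟨hβ, k, hk⟩ := ha
  simp only at hβ hk
  subst hk
  rcases lt_trichotomy k 0 with h | h | h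
  · right
    have := T.pos_iff_aux (T.neg_mem hβ) (k := -k) (by omega)
    simpa using this
  · subst h
    rcases T.pos_or β hβ with h | h
    · left; simpa using T.pos_zero h
    · right; simpa using T.pos_zero h
  · left; exact T.pos_iff_aux hβ h

lemma sr_mem (i) : T.sr i ∈ T.Phi := by
  cases i with
  | none => exact ⟨T.neg_mem (T.pos_sub _ T.hi_mem), 1, by simp [sr]⟩
  | some j => exact ⟨T.pos_sub _ (T.simple_mem j), 0, by simp [sr]⟩

lemma sr_pos (i) : T.Pos (T.sr i) := by
  intro k; rw [crd_sr]; split_ifs <;> norm_num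

lemma rr_mem {a b : V × ℝ} (ha : a ∈ T.Phi) (hb : b ∈ T.Phi) : rr a b ∈ T.Phi := by
  obtain ⟨ha1, k, hk⟩ := ha
  obtain ⟨hb1, m, hm⟩ := hb
  obtain ⟨p, hp⟩ := T.cryst _ ha1 _ hb1
  refine ⟨T.refl_mem _ ha1 _ hb1, m - p * k, ?_⟩
  simp [rr, hk, hm, hp]

/-- The simple reflection permutes positive roots other than its own. -/
lemma rr_pos {i} {b : V × ℝ} (hb : b ∈ T.Phi) (hp : T.Pos b) (hne : b ≠ T.sr i) :
    T.Pos (rr (T.sr i) b) := by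
  by_contra hneg
  have hmem := T.rr_mem (T.sr_mem i) hb
  have hneg' := (T.pos_or_neg hmem).resolve_left hneg
  have hz : ∀ k, k ≠ i → T.crd b k = 0 := by
    intro k hk
    have := hneg' k
    rw [crd_neg, rr, crd_sub, crd_sr, if_neg (Ne.symm hk)] at this
    have h2 := hp k
    linarith
  have hb' : b = T.crd b i • T.sr i := by
    conv_lhs => rw [T.expand b]
    rw [Finset.sum_eq_single i]
    · intro k _ hk; rw [hz k hk, zero_smul]
    · simp
  have h1 : T.crd b i • (T.sr i).1 ∈ T.R := by
    have := hb.1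
    rw [hb'] at this
    exact this
  rcases T.reduced _ (T.sr_mem i).1 _ h1 with h | h
  · rw [h, one_smul] at hb'; exact hne hb'
  · have := hp i; rw [h] at this; norm_num at this

lemma val_rr (a b : V × ℝ) (x : V) : T.val (rr a b) x = T.val b (T.s a x) := by
  simp only [val, rr, s, Prod.fst_sub, Prod.snd_sub, Prod.smul_fst, Prod.smul_snd,
    inner_sub_left, inner_sub_right, real_inner_smul_left, real_inner_smul_right, smul_eq_mul]
  rw [real_inner_comm b.1 (coroot a.1)]
  ring

lemma val_s_self {a : V × ℝ} (ha : a.1 ≠ 0) (x : V) : T.val a (T.s a x) = - T.val a x := by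
  have h := coroot_inner_self ha
  rw [real_inner_comm] at h
  simp only [s, val, inner_sub_left, real_inner_smul_left, h]
  ring

lemma s_s {a : V × ℝ} (ha : a.1 ≠ 0) (x : V) : T.s a (T.s a x) = x := by
  conv_lhs => rw [s]
  rw [T.val_s_self ha, s]
  module

lemma coroot_refl (α β : V) :
    coroot (β - ⟪β, coroot α⟫ • α) = coroot β - ⟪α, coroot β⟫ • coroot α := by
  by_cases h : α = 0
  · simp [h]
  have hαα : ⟪α, α⟫ ≠ 0 := fun hc => h (inner_self_eq_zero.mp hc)
  have hn : ⟪β - ⟪β, coroot α⟫ • α, β - ⟪β, coroot α⟫ • α⟫ = ⟪β, β⟫ := by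
    simp only [coroot, inner_sub_left, inner_sub_right, real_inner_smul_left,
      real_inner_smul_right, real_inner_comm β α]
    field_simp
    ring
  rw [coroot, hn, smul_sub, coroot, smul_smul]
  congr 1
  simp only [coroot, real_inner_smul_right, smul_smul, real_inner_comm β α]
  congr 1
  ring

lemma s_rr {a : V × ℝ} (b : V × ℝ) (ha : a.1 ≠ 0) (x : V) :
    T.s (rr a b) (T.s a x) = T.s a (T.s b x) := by
  have h1 : T.val (rr a b) (T.s a x) = T.val b x := by rw [val_rr, T.s_s ha]
  conv_lhs => rw [s, h1]
  have h2 : (rr a b).1 = b.1 - ⟪b.1, coroot a.1⟫ • a.1 := rfl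
  rw [h2, coroot_refl]
  simp only [s, val, inner_sub_left, real_inner_smul_left]
  rw [real_inner_comm (coroot b.1) a.1]
  module

/-- Words in the simple reflections, acting on points. -/
def word : List (Option (Fin T.n)) → V → V
  | [], x => x
  | i :: l, x => T.s (T.sr i) (word l x)

/-- Words in the simple reflections, acting on roots. -/
def wordR : List (Option (Fin T.n)) → V × ℝ → V × ℝ
  | [], x => x
  | i :: l, x => rr (T.sr i) (wordR l x)

lemma word_append (l l' x) : T.word (l ++ l') x = T.word l (T.word l' x) := by
  induction l with
  | nil => rfl
  | cons i l ih => simp [word, ih]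

lemma sr_ne (i) : (T.sr i).1 ≠ 0 := T.ne_zero (T.sr_mem i).1

lemma wordR_mem (l) {b : V × ℝ} (hb : b ∈ T.Phi) : T.wordR l b ∈ T.Phi := by
  induction l with
  | nil => exact hb
  | cons i l ih => exact T.rr_mem (T.sr_mem i) ih

lemma val_wordR (l b x) : T.val (T.wordR l b) (T.word l x) = T.val b x := by
  induction l with
  | nil => rfl
  | cons i l ih => rw [word, wordR, val_rr, T.s_s (T.sr_ne i), ih]

lemma s_wordR (l b x) : T.s (T.wordR l b) (T.word l x) = T.word l (T.s b x) := by
  induction l with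
  | nil => rfl
  | cons i l ih => rw [word, wordR, T.s_rr _ (T.sr_ne i), ih]; rfl

lemma deletion (l k) : T.Pos (T.wordR l (T.sr k)) ∨
    ∃ l' : List (Option (Fin T.n)), l'.length < l.length ∧
      ∀ x, T.word l (T.s (T.sr k) x) = T.word l' x := by
  induction l with
  | nil => left; exact T.sr_pos k
  | cons i l ih =>
    rcases ih with h | ⟨l', h1, h2⟩
    · by_cases he : T.wordR l (T.sr k) = T.sr i
      · right
        refine ⟨l, by simp, fun x => ?_⟩
        rw [word, ← s_wordR, he, T.s_s (T.sr_ne i)]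
      · left
        exact T.rr_pos (T.wordR_mem l (T.sr_mem k)) h he
    · right
      refine ⟨i :: l', by simpa using h1, fun x => ?_⟩
      rw [word, h2]; rfl

/-- The alcove. -/
def A : Set V := {x | ∀ i, 0 ≤ T.val (T.sr i) x}

lemma val_nonneg {x : V} (hx : x ∈ T.A) {a : V × ℝ} (ha : T.Pos a) : 0 ≤ T.val a x := by
  rw [T.val_expand]
  exact Finset.sum_nonneg fun i _ => mul_nonneg (ha i) (hx i)

lemma mem_A {x : V} : x ∈ T.A ↔ ∀ β ∈ T.Rp, 0 ≤ ⟪x, β⟫ ∧ ⟪x, β⟫ ≤ (T.c : ℝ) := by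
  constructor
  · intro hx β hβ
    have h1 := T.val_nonneg hx (T.pos_zero hβ)
    have h2 := T.val_nonneg hx (T.pos_iff_aux (T.neg_mem (T.pos_sub _ hβ)) le_rfl)
    simp only [val, inner_neg_right] at h1 h2
    push_cast at h2
    constructor <;> linarith
  · intro h i
    cases i with
    | none =>
      have := (h _ T.hi_mem).2
      simp only [val, sr, inner_neg_right]; linarith
    | some j =>
      have := (h _ (T.simple_mem j)).1
      simp only [val, sr]; linarith

lemma unique_aux (N : ℕ) : ∀ l : List (Option (Fin T.n)), l.length ≤ N → ∀ x ∈ T.A,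
    T.word l x ∈ T.A → T.word l x = x := by
  induction N with
  | zero =>
    intro l hl x _ _
    have : l = [] := List.length_eq_zero_iff.mp (by omega)
    subst this; rfl
  | succ N ih =>
    intro l hl x hx hy
    rcases List.eq_nil_or_concat l with rfl | ⟨l0, k, rfl⟩
    · rfl
    · rw [List.concat_eq_append] at hl hy ⊢
      rw [List.length_append] at hl
      simp only [List.length_singleton] at hl
      have he : ∀ x, T.word (l0 ++ [k]) x = T.word l0 (T.s (T.sr k) x) := by
        intro x; rw [word_append]; rfl
      rcases T.deletion l0 k with h | ⟨l', h1, h2⟩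
      · have h1 := T.val_nonneg hy h
        rw [he, val_wordR, T.val_s_self (T.sr_ne k)] at h1
        have h2 := hx k
        have h3 : T.val (T.sr k) x = 0 := by linarith
        have h4 : T.s (T.sr k) x = x := by rw [s, h3]; simp
        rw [he, h4] at hy ⊢
        exact ih l0 (by omega) x hx hy
      · rw [he, h2] at hy ⊢
        exact ih l' (by omega) x hx hy

lemma unique (l x) (hx : x ∈ T.A) (hy : T.word l x ∈ T.A) : T.word l x = x :=
  T.unique_aux _ l le_rfl x hx hy

/-- Height. -/
def ht (a : V × ℝ) : ℝ := ∑ i, T.crd a i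

lemma gen_aux (N : ℕ) : ∀ a ∈ T.Phi, T.Pos a → T.ht a < N →
    ∃ l, ∀ x, T.s a x = T.word l x := by
  induction N with
  | zero =>
    intro a _ hp hh
    have : 0 ≤ T.ht a := Finset.sum_nonneg fun i _ => hp i
    push_cast at hh
    linarith
  | succ N ih =>
    intro a ha hp hh
    have hpos : 0 < ⟪a.1, a.1⟫ := real_inner_self_pos.mpr (T.ne_zero ha.1)
    have hex : ∃ i, 0 < T.crd a i * ⟪a.1, (T.sr i).1⟫ := by
      by_contra hcon
      push Not at hcon
      have h1 : ⟪a.1, a.1⟫ = ∑ i, T.crd a i * ⟪a.1, (T.sr i).1⟫ := by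
        have h := congrArg Prod.fst (T.expand a)
        rw [Prod.fst_sum] at h
        calc ⟪a.1, a.1⟫ = ⟪a.1, ∑ i, (T.crd a i • T.sr i).1⟫ := by rw [← h]
          _ = _ := by
            rw [inner_sum]
            simp only [Prod.smul_fst, real_inner_smul_right]
      have := Finset.sum_nonpos fun i (_ : i ∈ Finset.univ) => hcon i
      linarith
    obtain ⟨i, hi⟩ := hex
    have hi' : 0 < ⟪a.1, (T.sr i).1⟫ := by
      by_contra hcon
      have := mul_nonneg (hp i) (neg_nonneg.2 (not_lt.1 hcon))
      linarith
    by_cases he : a = T.sr i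
    · exact ⟨[i], fun x => by rw [he]; rfl⟩
    · have h1 := inner_coroot_pos hi'
      obtain ⟨p, hpp⟩ := T.cryst _ (T.sr_mem i).1 _ ha.1
      have h2 : (1:ℝ) ≤ ⟪a.1, coroot (T.sr i).1⟫ := by
        rw [hpp] at h1 ⊢
        have : 0 < p := by exact_mod_cast h1
        exact_mod_cast this
      have h3 : T.ht (rr (T.sr i) a) = T.ht a - ⟪a.1, coroot (T.sr i).1⟫ := by
        simp [ht, rr, crd_sub, crd_sr, Finset.sum_sub_distrib]
      obtain ⟨l, hl⟩ := ih _ (T.rr_mem (T.sr_mem i) ha) (T.rr_pos ha hp he) (by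
        push_cast at hh; linarith)
      refine ⟨i :: (l ++ [i]), fun x => ?_⟩
      rw [word, word_append, ← hl]
      change _ = T.s (T.sr i) (T.s (rr (T.sr i) a) (T.s (T.sr i) x))
      rw [T.s_rr _ (T.sr_ne i), T.s_s (T.sr_ne i)]

lemma s_neg (a : V × ℝ) (x : V) : T.s (-a) x = T.s a x := by
  simp only [s, val, Prod.fst_neg, Prod.snd_neg, coroot_neg, inner_neg_right]
  module

lemma gen {a : V × ℝ} (ha : a ∈ T.Phi) : ∃ l, ∀ x, T.s a x = T.word l x := by
  rcases T.pos_or_neg ha with h | h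
  · obtain ⟨N, hN⟩ := exists_nat_gt (T.ht a)
    exact T.gen_aux N a ha h hN
  · obtain ⟨N, hN⟩ := exists_nat_gt (T.ht (-a))
    obtain ⟨l, hl⟩ := T.gen_aux N (-a) ⟨T.neg_mem ha.1, by
      obtain ⟨k, hk⟩ := ha.2
      exact ⟨-k, by simp [hk]⟩⟩ h hN
    exact ⟨l, fun x => by rw [← hl, s_neg]⟩

/-- The dual lattice of the span of `R`. -/
def L : AddSubgroup V where
  carrier := {x | ∀ β ∈ T.R, ∃ k : ℤ, ⟪x, β⟫ = (k : ℝ)}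
  zero_mem' := fun β _ => ⟨0, by simp⟩
  add_mem' := by
    intro x y hx hy β hβ
    obtain ⟨k, hk⟩ := hx β hβ
    obtain ⟨m, hm⟩ := hy β hβ
    exact ⟨k + m, by rw [inner_add_left, hk, hm]; push_cast; rfl⟩
  neg_mem' := by
    intro x hx β hβ
    obtain ⟨k, hk⟩ := hx β hβ
    exact ⟨-k, by rw [inner_neg_left, hk]; push_cast; rfl⟩

lemma mem_L {x : V} : x ∈ T.L ↔ ∀ β ∈ T.R, ∃ k : ℤ, ⟪x, β⟫ = (k : ℝ) := Iff.rfl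

/-- Translation lattice. -/
def N : AddSubgroup V := AddSubgroup.closure {x | ∃ β ∈ T.R, x = (T.c : ℝ) • coroot β}

lemma coroot_mem_L {β : V} (hβ : β ∈ T.R) : coroot β ∈ T.L := by
  intro α hα
  obtain ⟨k, hk⟩ := T.cryst β hβ α hα
  exact ⟨k, by rw [real_inner_comm, hk]⟩

lemma int_smul_mem (G : AddSubgroup V) {x : V} (hx : x ∈ G) (k : ℤ) : (k : ℝ) • x ∈ G := by
  rw [Int.cast_smul_eq_zsmul]
  exact G.zsmul_mem hx k

lemma N_le_L : T.N ≤ T.L := by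
  rw [N, AddSubgroup.closure_le]
  rintro x ⟨β, hβ, rfl⟩
  exact int_smul_mem _ (T.coroot_mem_L hβ) _

lemma s_mem_L {a : V × ℝ} (ha : a ∈ T.Phi) {x : V} (hx : x ∈ T.L) : T.s a x ∈ T.L := by
  obtain ⟨k, hk⟩ := hx _ ha.1
  obtain ⟨m, hm⟩ := ha.2
  have : T.val a x = ((k + m * T.c : ℤ) : ℝ) := by rw [val, hk, hm]; push_cast; rfl
  rw [s, this]
  exact T.L.sub_mem hx (int_smul_mem _ (T.coroot_mem_L ha.1) _)

lemma word_mem_L (l) {x : V} (hx : x ∈ T.L) : T.word l x ∈ T.L := by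
  induction l with
  | nil => exact hx
  | cons i l ih => exact T.s_mem_L (T.sr_mem i) ih

lemma ext_inner {x y : V} (h : ∀ β ∈ T.R, ⟪x, β⟫ = ⟪y, β⟫) : x = y := by
  have : ∀ v ∈ Submodule.span ℝ (T.R : Set V), ⟪x, v⟫ = ⟪y, v⟫ := by
    intro v hv
    induction hv using Submodule.span_induction with
    | mem v hv => exact h v hv
    | zero => simp
    | add u v _ _ hu hv => rw [inner_add_right, inner_add_right, hu, hv]
    | smul r v _ hv => rw [real_inner_smul_right, real_inner_smul_right, hv]
  rw [T.span_top] at this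
  exact ext_inner_right ℝ fun v => this v trivial

/-- Subsets of `L` bounded against every root are finite. -/
lemma finite_of_bdd (X : Set V) (hX : X ⊆ T.L) (C : ℝ)
    (hC : ∀ x ∈ X, ∀ β ∈ T.R, |⟪x, β⟫| ≤ C) : X.Finite := by
  obtain ⟨M, hM⟩ := exists_nat_ge C
  have hfin : (Set.univ.pi fun _ : T.R => (Set.Icc (-(M:ℤ)) M)).Finite :=
    Set.Finite.pi fun _ => Set.finite_Icc _ _
  refine Set.Finite.of_finite_image (f := fun x (β : T.R) => ⌊⟪x, β.1⟫⌋)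
    (hfin.subset ?_) ?_
  · rintro _ ⟨x, hx, rfl⟩ β _
    obtain ⟨k, hk⟩ := hX hx β.1 β.2
    have h1 := (hC x hx β.1 β.2).trans hM
    simp only [hk, Int.floor_intCast]
    rw [hk, abs_le] at h1
    exact ⟨by exact_mod_cast h1.1, by exact_mod_cast h1.2⟩
  · intro x hx y hy hxy
    apply T.ext_inner
    intro β hβ
    obtain ⟨k, hk⟩ := hX hx β hβ
    obtain ⟨m, hm⟩ := hX hy β hβ
    have := congrFun hxy ⟨β, hβ⟩
    simp only [hk, hm, Int.floor_intCast] at this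
    rw [hk, hm, this]

lemma finite_ball (z : V) (r : ℝ) : {x | x ∈ T.L ∧ ‖x - z‖ ≤ r}.Finite := by
  apply T.finite_of_bdd _ (fun x hx => hx.1) ((r + ‖z‖) * ∑ β ∈ T.R, ‖β‖)
  rintro x ⟨_, hx⟩ β hβ
  have h1 := abs_real_inner_le_norm x β
  have h2 : ‖x‖ ≤ r + ‖z‖ := by
    have := norm_add_le (x - z) z
    rw [sub_add_cancel] at this
    linarith
  have h3 : ‖β‖ ≤ ∑ β ∈ T.R, ‖β‖ :=
    Finset.single_le_sum (f := fun β : V => ‖β‖) (fun _ _ => norm_nonneg _) hβ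
  refine h1.trans (mul_le_mul h2 h3 (norm_nonneg _) ((norm_nonneg _).trans h2))

lemma finite_alcove : {x | x ∈ T.L ∧ x ∈ T.A}.Finite := by
  apply T.finite_of_bdd _ (fun x hx => hx.1) T.c
  rintro x ⟨_, hx⟩ β hβ
  rw [mem_A] at hx
  rcases T.pos_or β hβ with h | h
  · have := hx _ h
    rw [abs_le]; constructor <;> linarith
  · have := hx _ h
    rw [inner_neg_right] at this
    rw [abs_le]; constructor <;> linarith

lemma exists_interior : ∃ z : V, ∀ i, 0 < T.val (T.sr i) z := by
  let B : LinearMap.BilinForm ℝ V := innerₗ V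
  obtain ⟨z0, hz0⟩ : ∃ z0 : V, ∀ j, ⟪z0, T.b j⟫ = 1 := by
    let f : V →ₗ[ℝ] ℝ := T.b.constr ℝ fun _ => (1:ℝ)
    refine ⟨(InnerProductSpace.toDual ℝ V).symm (LinearMap.toContinuousLinearMap f), fun j => ?_⟩
    rw [InnerProductSpace.toDual_symm_apply]
    simp [f]
  have hc : (0:ℝ) < T.c := by exact_mod_cast T.c_pos
  have hp : 0 < 1 + |⟪z0, T.hi⟫| := by positivity
  refine ⟨(T.c / (1 + |⟪z0, T.hi⟫|)) • z0, fun i => ?_⟩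
  cases i with
  | none =>
    simp only [val, sr, real_inner_smul_left, inner_neg_right]
    have h1 : T.c / (1 + |⟪z0, T.hi⟫|) * ⟪z0, T.hi⟫ < T.c := by
      rw [div_mul_eq_mul_div, div_lt_iff₀ hp]
      have := le_abs_self ⟪z0, T.hi⟫
      nlinarith
    linarith
  | some j =>
    simp only [val, sr, real_inner_smul_left, hz0]
    have : 0 < T.c / (1 + |⟪z0, T.hi⟫|) := by positivity
    linarith

lemma dist_lt {a : V × ℝ} (ha : a.1 ≠ 0) {x z : V} (hx : T.val a x < 0) (hz : 0 < T.val a z) :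
    ‖T.s a x - z‖ < ‖x - z‖ := by
  have hpos : 0 < ⟪a.1, a.1⟫ := real_inner_self_pos.mpr ha
  have h1 : ‖T.s a x - z‖ ^ 2 = ‖x - z‖ ^ 2 + 4 * T.val a x * T.val a z / ⟪a.1, a.1⟫ := by
    have h2 : ⟪x - z, a.1⟫ = T.val a x - T.val a z := by simp only [val, inner_sub_left]; ring
    rw [s, show x - T.val a x • coroot a.1 - z = (x - z) - T.val a x • coroot a.1 by abel,
      norm_sub_sq_real, ← real_inner_self_eq_norm_sq (T.val a x • coroot a.1)]
    simp only [coroot, real_inner_smul_left, real_inner_smul_right, h2]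
    field_simp
    ring
  have h3 : 4 * T.val a x * T.val a z / ⟪a.1, a.1⟫ < 0 :=
    div_neg_of_neg_of_pos (by nlinarith) hpos
  exact lt_of_pow_lt_pow_left₀ 2 (norm_nonneg _) (by linarith)

lemma exists_word {x : V} (hx : x ∈ T.L) : ∃ l, T.word l x ∈ T.A := by
  obtain ⟨z, hz⟩ := T.exists_interior
  let X : Set V := {y | ∃ l, T.word l x = y} ∩ {y | y ∈ T.L ∧ ‖y - z‖ ≤ ‖x - z‖}
  have hfin : X.Finite := (T.finite_ball z _).subset Set.inter_subset_right
  have hne : X.Nonempty := ⟨x, ⟨[], rfl⟩, hx, le_rfl⟩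
  obtain ⟨y, ⟨⟨l, rfl⟩, hyL, hyd⟩, hmin⟩ := Set.exists_min_image X (fun y => ‖y - z‖) hfin hne
  refine ⟨l, fun i => ?_⟩
  by_contra hcon
  have hlt := T.dist_lt (T.sr_ne i) (not_le.1 hcon) (hz i)
  have := hmin (T.s (T.sr i) (T.word l x)) ⟨⟨i :: l, rfl⟩, T.s_mem_L (T.sr_mem i) hyL,
    hlt.le.trans hyd⟩
  linarith

end RSys

/-- Orthogonal reflection. -/
def refl (α : V) : V ≃ₗᵢ[ℝ] V := (Submodule.span ℝ {α})ᗮ.reflection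

lemma refl_apply (α x : V) : refl α x = x - ⟪x, α⟫ • coroot α := by
  rw [refl, Submodule.reflection_orthogonal_apply, Submodule.reflection_singleton_apply, coroot]
  simp only [RCLike.ofReal_real_eq_id, id_eq]
  rw [← real_inner_self_eq_norm_sq, real_inner_comm x α, smul_smul]
  rw [← Nat.cast_smul_eq_nsmul ℝ, smul_smul, neg_sub]
  congr 2
  push_cast
  ring

lemma refl_apply' (α x : V) : refl α x = x - ⟪x, coroot α⟫ • α := by
  rw [refl_apply, coroot, smul_smul, real_inner_smul_right, mul_comm]

lemma refl_coroot (α : V) : refl (coroot α) = refl α := by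
  ext x
  rw [refl_apply, refl_apply', coroot_coroot]

/-- Weyl group as linear isometries. -/
def WG (R : Finset V) : Subgroup (V ≃ₗᵢ[ℝ] V) := Subgroup.closure {w | ∃ α ∈ R, w = refl α}

/-- A pair of stable subgroups. -/
structure Lat (W : Subgroup (V ≃ₗᵢ[ℝ] V)) where
  L : AddSubgroup V
  N : AddSubgroup V
  hL : ∀ w ∈ W, ∀ x ∈ L, w x ∈ L
  hN : ∀ w ∈ W, ∀ x ∈ N, w x ∈ N

namespace Lat
variable {W : Subgroup (V ≃ₗᵢ[ℝ] V)} (Λ : Lat W)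

/-- The quotient. -/
abbrev G : Type _ := Λ.L ⧸ (Λ.N.addSubgroupOf Λ.L)

/-- Quotient map. -/
def qmk (x : V) (hx : x ∈ Λ.L) : Λ.G := QuotientAddGroup.mk ⟨x, hx⟩

lemma mk_surj (g : Λ.G) : ∃ x hx, g = Λ.qmk x hx := by
  obtain ⟨⟨x, hx⟩, rfl⟩ := QuotientAddGroup.mk_surjective g
  exact ⟨x, hx, rfl⟩

lemma mk_eq {x y : V} {hx hy} : Λ.qmk x hx = Λ.qmk y hy ↔ y - x ∈ Λ.N := by
  rw [qmk, qmk, QuotientAddGroup.eq, AddSubgroup.mem_addSubgroupOf]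
  simp [neg_add_eq_sub]

lemma mk_add {x y : V} {hx hy} : Λ.qmk x hx + Λ.qmk y hy = Λ.qmk (x + y) (Λ.L.add_mem hx hy) := rfl

/-- Action on `L`. -/
def act (w : W) : Λ.L →+ Λ.L where
  toFun x := ⟨w.1 x.1, Λ.hL _ w.2 _ x.2⟩
  map_zero' := by ext; simp
  map_add' x y := by ext; simp

/-- Action on the quotient. -/
def actG (w : W) : Λ.G →+ Λ.G :=
  QuotientAddGroup.map _ _ (Λ.act w) (by
    intro x hx
    exact Λ.hN _ w.2 _ hx)

lemma actG_mk (w : W) (x hx) : Λ.actG w (Λ.qmk x hx) = Λ.qmk (w.1 x) (Λ.hL _ w.2 _ hx) := rfl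

instance : DistribMulAction W Λ.G where
  smul w g := Λ.actG w g
  one_smul g := by
    obtain ⟨x, hx, rfl⟩ := Λ.mk_surj g
    rfl
  mul_smul w v g := by
    obtain ⟨x, hx, rfl⟩ := Λ.mk_surj g
    rfl
  smul_zero w := map_zero (Λ.actG w)
  smul_add w := map_add (Λ.actG w)

lemma smul_mk (w : W) (x hx) : w • (Λ.qmk x hx) = Λ.qmk (w.1 x) (Λ.hL _ w.2 _ hx) := rfl

end Lat

/-- Brauer's permutation lemma (inequality form). -/
lemma brauer_le {W G H : Type*} [Group W] [Finite W] [AddCommGroup G] [AddCommGroup H] [Finite G]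
    [Finite H] [DistribMulAction W G] [DistribMulAction W H] (B : G → AddChar H ℂ)
    (hB : Function.Injective B) (hW : ∀ (w : W) g h, B (w • g) (w • h) = B g h) :
    Nat.card (MulAction.orbitRel.Quotient W G) ≤ Nat.card (MulAction.orbitRel.Quotient W H) := by
  have := Fintype.ofFinite W
  have := Fintype.ofFinite G
  have := Fintype.ofFinite H
  have key : ∀ w : W, Fintype.card (MulAction.fixedBy G w) ≤
      Fintype.card (MulAction.fixedBy H w) := by
    intro w
    let D : H →+ H := DistribSMul.toAddMonoidHom H w - AddMonoidHom.id H
    have hD : ∀ h, D h = w • h - h := fun h => rfl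
    have htriv : ∀ g ∈ MulAction.fixedBy G w, ∀ h, B g (D h) = 1 := by
      intro g hg h
      rw [hD, AddChar.map_sub_eq_div]
      have h1 := hW w g h
      rw [MulAction.mem_fixedBy.1 hg] at h1
      rw [h1]
      apply div_self
      intro h0
      have h2 := AddChar.map_add_eq_mul (B g) h (-h)
      rw [add_neg_cancel, AddChar.map_zero_eq_one, h0, zero_mul] at h2
      exact one_ne_zero h2
    let F : MulAction.fixedBy G w → AddChar (H ⧸ D.range) ℂ := fun g =>
      AddChar.toAddMonoidHomEquiv.symm (QuotientAddGroup.lift D.range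
        (AddChar.toAddMonoidHomEquiv (B g.1)) (by
          rintro _ ⟨h, rfl⟩
          exact htriv g.1 g.2 h))
    have hF : ∀ g (h : H), F g (QuotientAddGroup.mk h) = B g.1 h := fun g h => rfl
    have hFinj : Function.Injective F := by
      intro g g' hgg
      apply Subtype.ext
      apply hB
      ext h
      rw [← hF, ← hF, hgg]
    have hc1 : Nat.card (MulAction.fixedBy G w) ≤ Nat.card (H ⧸ D.range) := by
      have := Fintype.ofFinite (H ⧸ D.range)
      calc _ ≤ Nat.card (AddChar (H ⧸ D.range) ℂ) := Nat.card_le_card_of_injective F hFinj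
        _ = _ := by rw [Nat.card_eq_fintype_card, AddChar.card_eq, Nat.card_eq_fintype_card]
    have hc2 : Nat.card (H ⧸ D.range) = Nat.card (MulAction.fixedBy H w) := by
      have e1 := AddSubgroup.card_eq_card_quotient_mul_card_addSubgroup D.range
      have e2 := AddSubgroup.card_eq_card_quotient_mul_card_addSubgroup D.ker
      have e3 : Nat.card (H ⧸ D.ker) = Nat.card D.range :=
        Nat.card_congr (QuotientAddGroup.quotientKerEquivRange D).toEquiv
      have e4 : Nat.card D.ker = Nat.card (MulAction.fixedBy H w) := by
        apply Nat.card_congr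
        apply Equiv.subtypeEquivRight
        intro h
        rw [AddMonoidHom.mem_ker, hD, sub_eq_zero, MulAction.mem_fixedBy]
      rw [← e4]
      rw [e3, e1, mul_comm] at e2
      exact Nat.eq_of_mul_eq_mul_left Nat.card_pos e2
    rw [← Nat.card_eq_fintype_card, ← Nat.card_eq_fintype_card]
    exact hc1.trans hc2.le
  have b1 := MulAction.sum_card_fixedBy_eq_card_orbits_mul_card_group W G
  have b2 := MulAction.sum_card_fixedBy_eq_card_orbits_mul_card_group W H
  have h := Finset.sum_le_sum fun w (_ : w ∈ Finset.univ) => key w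
  rw [b1, b2] at h
  rw [Nat.card_eq_fintype_card, Nat.card_eq_fintype_card]
  exact Nat.le_of_mul_le_mul_right h Fintype.card_pos

namespace RSys
variable (T : RSys V)

lemma WG_mem_R {w : V ≃ₗᵢ[ℝ] V} (hw : w ∈ WG T.R) : ∀ β ∈ T.R, w β ∈ T.R := by
  induction hw using Subgroup.closure_induction with
  | mem w hw =>
    obtain ⟨α, hα, rfl⟩ := hw
    intro β hβ
    rw [refl_apply']
    exact T.refl_mem α hα β hβ
  | one => intro β hβ; exact hβ
  | mul w v _ _ hw hv => intro β hβ; exact hw _ (hv _ hβ)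
  | inv w _ hw =>
    intro β hβ
    have hinj : Function.Injective (fun x : T.R => (⟨w x.1, hw _ x.2⟩ : T.R)) := by
      intro x y hxy
      exact Subtype.ext (w.injective (congrArg Subtype.val hxy))
    obtain ⟨γ, hγ⟩ := (Finite.injective_iff_surjective.1 hinj) ⟨β, hβ⟩
    have : w γ.1 = β := congrArg Subtype.val hγ
    rw [← this]
    change w.symm (w γ.1) ∈ T.R
    rw [LinearIsometryEquiv.symm_apply_apply]
    exact γ.2

instance WG_finite : Finite (WG T.R) := by
  apply Finite.of_injective
    (fun (w : WG T.R) (β : T.R) => (⟨w.1 β.1, T.WG_mem_R w.2 _ β.2⟩ : T.R))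
  intro w v h
  apply Subtype.ext
  have h1 : ∀ β ∈ T.R, w.1 β = v.1 β := fun β hβ =>
    congrArg Subtype.val (congrFun h ⟨β, hβ⟩)
  have h2 : w.1.toLinearEquiv.toLinearMap = v.1.toLinearEquiv.toLinearMap :=
    LinearMap.ext_on T.span_top fun β hβ => h1 β hβ
  ext x
  exact LinearMap.congr_fun h2 x

lemma WG_coroot {w : V ≃ₗᵢ[ℝ] V} (β : V) : w (coroot β) = coroot (w β) := by
  simp [coroot]

lemma WG_L {w : V ≃ₗᵢ[ℝ] V} (hw : w ∈ WG T.R) : ∀ x ∈ T.L, w x ∈ T.L := by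
  intro x hx β hβ
  obtain ⟨k, hk⟩ := hx _ (T.WG_mem_R (inv_mem hw) β hβ)
  refine ⟨k, ?_⟩
  rw [← hk]
  have := w.inner_map_map x (w⁻¹ β)
  rw [← this]
  congr 1
  exact (w.apply_symm_apply β).symm

lemma WG_N {w : V ≃ₗᵢ[ℝ] V} (hw : w ∈ WG T.R) : ∀ x ∈ T.N, w x ∈ T.N := by
  intro x hx
  induction hx using AddSubgroup.closure_induction with
  | mem x hx =>
    obtain ⟨β, hβ, rfl⟩ := hx
    rw [map_smul, WG_coroot]
    exact AddSubgroup.subset_closure ⟨_, T.WG_mem_R hw β hβ, rfl⟩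
  | zero => rw [map_zero]; exact zero_mem _
  | add x y _ _ hx hy => rw [map_add]; exact add_mem hx hy
  | neg x _ hx => rw [map_neg]; exact T.N.neg_mem hx

/-- The lattice pair of a root system. -/
def lat {W : Subgroup (V ≃ₗᵢ[ℝ] V)} (hW : W = WG T.R) : Lat W where
  L := T.L
  N := T.N
  hL := fun _ hw => T.WG_L (hW ▸ hw)
  hN := fun _ hw => T.WG_N (hW ▸ hw)

/-- Words act through the Weyl group modulo translations. -/
lemma word_to_WG (l x) : ∃ w ∈ WG T.R, T.word l x - w x ∈ T.N := by
  induction l with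
  | nil => exact ⟨1, one_mem _, by simp [word, zero_mem]⟩
  | cons i l ih =>
    obtain ⟨w, hw, h⟩ := ih
    have hm := T.sr_mem i
    have hr : refl (T.sr i).1 ∈ WG T.R := Subgroup.subset_closure ⟨_, hm.1, rfl⟩
    refine ⟨refl (T.sr i).1 * w, mul_mem hr hw, ?_⟩
    have h1 := T.WG_N hr _ h
    obtain ⟨k, hk⟩ := hm.2
    have h0 : (T.c : ℝ) • coroot (T.sr i).1 ∈ T.N :=
      AddSubgroup.subset_closure ⟨_, hm.1, rfl⟩
    have h2 : (k : ℝ) • ((T.c : ℝ) • coroot (T.sr i).1) ∈ T.N := int_smul_mem _ h0 _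
    have h3 := sub_mem h1 h2
    convert h3 using 1
    rw [map_sub, word, s, refl_apply _ (T.word l x), val, hk]
    change _ - refl (T.sr i).1 (w x) = _
    module

lemma N_to_word {q : V} (hq : q ∈ T.N) : ∀ x, ∃ l, T.word l x = x + q := by
  have base : ∀ β ∈ T.R, ∀ x, ∃ l, T.word l x = x + (T.c : ℝ) • coroot β := by
    intro β hβ x
    obtain ⟨l1, h1⟩ := T.gen (a := (β, 0)) ⟨hβ, 0, by simp⟩
    obtain ⟨l2, h2⟩ := T.gen (a := (β, -1)) ⟨hβ, -1, by simp⟩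
    refine ⟨l2 ++ l1, ?_⟩
    rw [word_append, ← h1, ← h2]
    have h3 := coroot_inner_self (T.ne_zero hβ)
    rw [real_inner_comm] at h3
    simp only [s, val, inner_sub_left, real_inner_smul_left, h3]
    module
  induction hq using AddSubgroup.closure_induction with
  | mem q hq =>
    obtain ⟨β, hβ, rfl⟩ := hq
    exact base β hβ
  | zero => exact fun x => ⟨[], by simp [word]⟩
  | add p q _ _ hp hq =>
    intro x
    obtain ⟨l1, h1⟩ := hp x
    obtain ⟨l2, h2⟩ := hq (x + p)
    exact ⟨l2 ++ l1, by rw [word_append, h1, h2, add_assoc]⟩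
  | neg q _ hq =>
    intro x
    obtain ⟨l, hl⟩ := hq (x + -q)
    refine ⟨l.reverse, ?_⟩
    have hrev : ∀ l x, T.word (List.reverse l) (T.word l x) = x := by
      intro l
      induction l with
      | nil => intro x; rfl
      | cons i l ih =>
        intro x
        rw [List.reverse_cons, word_append]
        change T.word l.reverse (T.s (T.sr i) (T.s (T.sr i) (T.word l x))) = x
        rw [T.s_s (T.sr_ne i), ih]
    have := hrev l (x + -q)
    rw [hl, neg_add_cancel_right] at this
    exact this

lemma WG_to_word {w : V ≃ₗᵢ[ℝ] V} (hw : w ∈ WG T.R) : ∀ x, ∃ l, T.word l x = w x := by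
  have base : ∀ α ∈ T.R, ∀ x, ∃ l, T.word l x = refl α x := by
    intro α hα x
    obtain ⟨l1, h1⟩ := T.gen (a := (α, 0)) ⟨hα, 0, by simp⟩
    exact ⟨l1, by rw [← h1, refl_apply]; simp [s, val]⟩
  induction hw using Subgroup.closure_induction'' with
  | mem w hw => obtain ⟨α, hα, rfl⟩ := hw; exact base α hα
  | inv_mem w hw =>
    obtain ⟨α, hα, rfl⟩ := hw
    intro x
    obtain ⟨l, hl⟩ := base α hα x
    refine ⟨l, hl.trans ?_⟩
    change _ = (refl α).symm x
    rw [refl, Submodule.reflection_symm]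
  | one => exact fun x => ⟨[], rfl⟩
  | mul v w _ _ hv hw =>
    intro x
    obtain ⟨l1, h1⟩ := hw x
    obtain ⟨l2, h2⟩ := hv (w x)
    exact ⟨l2 ++ l1, by rw [word_append, h1, h2]; rfl⟩

/-- The map from alcove points to orbits. -/
def toOrb {W : Subgroup (V ≃ₗᵢ[ℝ] V)} (hW : W = WG T.R) (x : {x | x ∈ T.L ∧ x ∈ T.A}) :
    MulAction.orbitRel.Quotient W (T.lat hW).G :=
  Quotient.mk _ ((T.lat hW).qmk x.1 x.2.1)

lemma toOrb_bij {W : Subgroup (V ≃ₗᵢ[ℝ] V)} (hW : W = WG T.R) :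
    Function.Bijective (T.toOrb hW) := by
  constructor
  · rintro ⟨x, hx⟩ ⟨y, hy⟩ h
    have h1 := Quotient.exact h
    obtain ⟨w, hw⟩ := MulAction.orbitRel_apply.1 h1
    simp only at hw
    change w • (T.lat hW).qmk y hy.1 = _ at hw
    replace hw : x - w.1 y ∈ T.N := ((T.lat hW).mk_eq (hx := T.WG_L (by rw [← hW]; exact w.2) y hy.1)
      (hy := hx.1)).1 hw
    obtain ⟨l1, h1⟩ := T.WG_to_word (by rw [← hW]; exact w.2 : w.1 ∈ WG T.R) y
    obtain ⟨l2, h2⟩ := T.N_to_word hw (w.1 y)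
    rw [add_sub_cancel, ← h1, ← word_append] at h2
    have h3 := T.unique _ y hy.2 (h2 ▸ hx.2)
    exact Subtype.ext (h2.symm.trans h3)
  · intro q
    obtain ⟨g, rfl⟩ := Quotient.exists_rep q
    obtain ⟨x, hx, rfl⟩ := (T.lat hW).mk_surj g
    obtain ⟨l, hl⟩ := T.exists_word hx
    refine ⟨⟨T.word l x, T.word_mem_L l hx, hl⟩, ?_⟩
    apply Quotient.sound
    apply MulAction.orbitRel_apply.2
    obtain ⟨w, hw, h⟩ := T.word_to_WG l x
    refine ⟨⟨w, hW ▸ hw⟩, ?_⟩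
    change (⟨w, hW ▸ hw⟩ : W) • (T.lat hW).qmk x hx = _
    exact ((T.lat hW).mk_eq (hx := T.WG_L hw x hx) (hy := T.word_mem_L l hx)).2 h

lemma card_alcove {W : Subgroup (V ≃ₗᵢ[ℝ] V)} (hW : W = WG T.R) :
    Nat.card {x | x ∈ T.L ∧ x ∈ T.A} = Nat.card (MulAction.orbitRel.Quotient W (T.lat hW).G) :=
  Nat.card_congr (Equiv.ofBijective _ (T.toOrb_bij hW))

lemma finite_G {W : Subgroup (V ≃ₗᵢ[ℝ] V)} (hW : W = WG T.R) : Finite (T.lat hW).G := by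
  have : Finite W := by rw [hW]; infer_instance
  have := T.finite_alcove.to_subtype
  have : Finite (MulAction.orbitRel.Quotient W (T.lat hW).G) :=
    Finite.of_surjective _ (T.toOrb_bij hW).2
  have e := MulAction.selfEquivSigmaOrbits W (T.lat hW).G
  have : ∀ ω : MulAction.orbitRel.Quotient W (T.lat hW).G,
      Finite (MulAction.orbit W (Quotient.out ω)) := fun ω => Set.finite_range _
  exact Finite.of_equiv _ e.symm

/-- Double dual property of the translation lattice. -/
lemma mem_N_of_dual {x : V} (h : ∀ y : V, (∀ β ∈ T.R, ∃ k : ℤ, ⟪y, coroot β⟫ = (k : ℝ)) →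
    ∃ k : ℤ, ⟪x, y⟫ = T.c * (k : ℝ)) : x ∈ T.N := by
  have hc : (T.c : ℝ) ≠ 0 := by exact_mod_cast T.c_pos.ne'
  let M : Submodule ℤ V := AddSubgroup.toIntSubmodule T.N
  have hM : ∀ v, v ∈ M ↔ v ∈ T.N := fun v => Iff.rfl
  have hdisc : DiscreteTopology M := by
    have hS : 0 < 1 + ∑ β ∈ T.R, ‖β‖ := by
      have : 0 ≤ ∑ β ∈ T.R, ‖β‖ := Finset.sum_nonneg fun _ _ => norm_nonneg _
      linarith
    apply DiscreteTopology.of_forall_le_norm (r := 1 / (1 + ∑ β ∈ T.R, ‖β‖)) (by positivity)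
    intro v hv
    have hv' : v.1 ≠ 0 := fun h0 => hv (Subtype.ext h0)
    have hvL : v.1 ∈ T.L := T.N_le_L v.2
    obtain ⟨β, hβ, hne⟩ : ∃ β ∈ T.R, ⟪v.1, β⟫ ≠ 0 := by
      by_contra hcon
      push Not at hcon
      exact hv' (T.ext_inner fun β hβ => by rw [hcon β hβ, inner_zero_left])
    obtain ⟨k, hk⟩ := hvL β hβ
    have h1 : (1:ℝ) ≤ |⟪v.1, β⟫| := by
      rw [hk] at hne ⊢
      have : k ≠ 0 := by exact_mod_cast hne
      exact_mod_cast Int.one_le_abs this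
    have h2 := abs_real_inner_le_norm v.1 β
    have h3 : ‖β‖ ≤ ∑ β ∈ T.R, ‖β‖ :=
      Finset.single_le_sum (f := fun β : V => ‖β‖) (fun _ _ => norm_nonneg _) hβ
    rw [div_le_iff₀ hS]
    have h4 : ‖v.1‖ * ‖β‖ ≤ ‖v.1‖ * (1 + ∑ β ∈ T.R, ‖β‖) :=
      mul_le_mul_of_nonneg_left (by linarith) (norm_nonneg _)
    change 1 ≤ ‖v.1‖ * _
    linarith
  have hspan : IsZLattice ℝ M := by
    constructor
    rw [eq_top_iff, ← T.span_top, Submodule.span_le]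
    intro β hβ
    have h1 : (T.c : ℝ) • coroot β ∈ Submodule.span ℝ (M : Set V) :=
      Submodule.subset_span (AddSubgroup.subset_closure ⟨β, hβ, rfl⟩)
    have h0 : ⟪β, β⟫ ≠ 0 := fun hc => T.ne_zero hβ (inner_self_eq_zero.mp hc)
    have h2 := Submodule.smul_mem _ (⟪β, β⟫ / 2 / T.c) h1
    have e : (⟪β, β⟫ / 2 / (T.c : ℝ)) • ((T.c : ℝ) • coroot β) = β := by
      rw [coroot, smul_smul, smul_smul]
      have e1 : ⟪β, β⟫ / 2 / (T.c:ℝ) * T.c * (2 / ⟪β, β⟫) = 1 := by field_simp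
      rw [e1, one_smul]
    rw [e] at h2
    exact h2
  have : Module.Finite ℤ M := ZLattice.module_finite ℝ M
  have : Module.Free ℤ M := ZLattice.module_free ℝ M
  let b := (Module.Free.chooseBasis ℤ M).ofZLatticeBasis ℝ M
  have hb : Submodule.span ℤ (Set.range b) = M :=
    (Module.Free.chooseBasis ℤ M).ofZLatticeBasis_span ℝ
  let B : LinearMap.BilinForm ℝ V := innerₗ V
  have hBa : ∀ u v, B u v = ⟪u, v⟫ := fun u v => rfl
  have hsymm : B.IsSymm := ⟨fun u v => by simp [hBa, real_inner_comm]⟩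
  have hnd : B.Nondegenerate := by
    constructor
    · intro u hu
      exact inner_self_eq_zero.1 (hu u)
    · intro u hu
      exact inner_self_eq_zero.1 (hu u)
  have hdd := LinearMap.BilinForm.dualSubmodule_dualSubmodule_of_basis (R := ℤ) B hnd hsymm b
  rw [hb] at hdd
  rw [← hM, ← hdd]
  intro y hy
  obtain ⟨k, hk⟩ := h ((T.c : ℝ) • y) (by
    intro β hβ
    obtain ⟨k, hk⟩ := Submodule.mem_one.1
      (hy ((T.c : ℝ) • coroot β) (AddSubgroup.subset_closure ⟨β, hβ, rfl⟩))
    refine ⟨k, ?_⟩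
    rw [hBa, real_inner_smul_right] at hk
    rw [real_inner_smul_left, ← hk]
    simp)
  rw [real_inner_smul_right] at hk
  refine Submodule.mem_one.2 ⟨k, ?_⟩
  rw [hBa, mul_left_cancel₀ hc hk]
  simp

end RSys

/-- Comparison of orbit numbers through the exponential pairing. -/
lemma Lat.orbits_le {W : Subgroup (V ≃ₗᵢ[ℝ] V)} [Finite W] (Λ M : Lat W) [Finite Λ.G] [Finite M.G]
    {c : ℝ} (hc : c ≠ 0)
    (h1 : ∀ x ∈ Λ.N, ∀ y ∈ M.L, ∃ k : ℤ, ⟪x, y⟫ = c * k)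
    (h2 : ∀ x ∈ Λ.L, ∀ y ∈ M.N, ∃ k : ℤ, ⟪x, y⟫ = c * k)
    (h3 : ∀ x ∈ Λ.L, (∀ y ∈ M.L, ∃ k : ℤ, ⟪x, y⟫ = c * k) → x ∈ Λ.N) :
    Nat.card (MulAction.orbitRel.Quotient W Λ.G) ≤
      Nat.card (MulAction.orbitRel.Quotient W M.G) := by
  let e : ℝ → ℂ := fun t => Complex.exp (2 * Real.pi * Complex.I * ((t / c : ℝ) : ℂ))
  have e0 : e 0 = 1 := by simp [e]
  have eadd : ∀ s t, e (s + t) = e s * e t := by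
    intro s t
    simp only [e]
    rw [← Complex.exp_add]
    congr 1
    push_cast
    ring
  have eone : ∀ t, e t = 1 ↔ ∃ k : ℤ, t = c * k := by
    intro t
    simp only [e]
    rw [Complex.exp_eq_one_iff]
    have hpi : (2 * Real.pi * Complex.I : ℂ) ≠ 0 := by
      simp [Real.pi_ne_zero]
    apply exists_congr
    intro k
    rw [mul_comm (k : ℂ), mul_right_inj' hpi, ← Complex.ofReal_intCast, Complex.ofReal_inj,
      div_eq_iff hc, mul_comm]
  have key : ∀ x ∈ Λ.L, ∀ x' ∈ Λ.L, x' - x ∈ Λ.N → ∀ y ∈ M.L, ∀ y' ∈ M.L, y' - y ∈ M.N →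
      e ⟪x', y'⟫ = e ⟪x, y⟫ := by
    intro x hx x' hx' hxx y hy y' hy' hyy
    have t1 : ⟪x', y'⟫ = ⟪x, y⟫ + (⟪x' - x, y'⟫ + ⟪x, y' - y⟫) := by
      simp only [inner_sub_left, inner_sub_right]
      ring
    rw [t1, eadd, eadd, (eone _).2 (h1 _ hxx _ hy'), (eone _).2 (h2 _ hx _ hyy)]
    simp
  choose rΛ hrΛ hΛ using Λ.mk_surj
  choose rM hrM hM using M.mk_surj
  let f : Λ.G → M.G → ℂ := fun g h => e ⟪rΛ g, rM h⟫
  have hf : ∀ x (hx : x ∈ Λ.L) y (hy : y ∈ M.L), f (Λ.qmk x hx) (M.qmk y hy) = e ⟪x, y⟫ := by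
    intro x hx y hy
    exact key _ hx _ (hrΛ _) (Λ.mk_eq.1 (hΛ (Λ.qmk x hx))) _ hy _ (hrM _)
      (M.mk_eq.1 (hM (M.qmk y hy)))
  let B : Λ.G → AddChar M.G ℂ := fun g =>
    { toFun := f g
      map_zero_eq_one' := by
        obtain ⟨x, hx, rfl⟩ := Λ.mk_surj g
        have := hf x hx 0 (zero_mem _)
        rw [inner_zero_right, e0] at this
        exact this
      map_add_eq_mul' := by
        intro h h'
        obtain ⟨x, hx, rfl⟩ := Λ.mk_surj g
        obtain ⟨y, hy, rfl⟩ := M.mk_surj h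
        obtain ⟨y', hy', rfl⟩ := M.mk_surj h'
        rw [M.mk_add, hf, hf, hf, inner_add_right, eadd] }
  have hB : ∀ g h, B g h = f g h := fun g h => rfl
  apply brauer_le B
  · intro g g' hgg
    obtain ⟨x, hx, rfl⟩ := Λ.mk_surj g
    obtain ⟨x', hx', rfl⟩ := Λ.mk_surj g'
    rw [Λ.mk_eq]
    apply h3 _ (Λ.L.sub_mem hx' hx)
    intro y hy
    rw [← eone]
    have h4 : e ⟪x, y⟫ = e ⟪x', y⟫ := by
      rw [← hf x hx y hy, ← hf x' hx' y hy, ← hB, ← hB, hgg]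
    have h5 := eadd ⟪x' - x, y⟫ ⟪x, y⟫
    rw [inner_sub_left, sub_add_cancel, h4] at h5
    have h6 : e ⟪x', y⟫ ≠ 0 := Complex.exp_ne_zero _
    rw [inner_sub_left]
    exact (mul_eq_right₀ h6).1 h5.symm
  · intro w g h
    obtain ⟨x, hx, rfl⟩ := Λ.mk_surj g
    obtain ⟨y, hy, rfl⟩ := M.mk_surj h
    rw [Λ.smul_mk, M.smul_mk, hB, hB, hf, hf, w.1.inner_map_map]

lemma RSys.orbits_le (T T' : RSys V) (hc : T.c = T'.c) (hR : ∀ β, β ∈ T'.R ↔ coroot β ∈ T.R)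
    {W : Subgroup (V ≃ₗᵢ[ℝ] V)} (hW : W = WG T.R) (hW' : W = WG T'.R) :
    Nat.card {x | x ∈ T.L ∧ x ∈ T.A} ≤ Nat.card {x | x ∈ T'.L ∧ x ∈ T'.A} := by
  rw [T.card_alcove hW, T'.card_alcove hW']
  have : Finite W := by rw [hW]; infer_instance
  have := T.finite_G hW
  have := T'.finite_G hW'
  have hc0 : (T.c : ℝ) ≠ 0 := by exact_mod_cast T.c_pos.ne'
  have aux : ∀ (T T' : RSys V), (∀ β ∈ T.R, coroot β ∈ T'.R) → ∀ x ∈ T.N, ∀ y ∈ T'.L,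
      ∃ k : ℤ, ⟪x, y⟫ = T.c * k := by
    intro T T' hR x hx y hy
    induction hx using AddSubgroup.closure_induction with
    | mem x hx =>
      obtain ⟨β, hβ, rfl⟩ := hx
      obtain ⟨k, hk⟩ := hy _ (hR β hβ)
      exact ⟨k, by rw [real_inner_smul_left, real_inner_comm, hk]⟩
    | zero => exact ⟨0, by simp⟩
    | add x x' _ _ hx hx' =>
      obtain ⟨k, hk⟩ := hx
      obtain ⟨k', hk'⟩ := hx'
      exact ⟨k + k', by rw [inner_add_left, hk, hk']; push_cast; ring⟩
    | neg x _ hx =>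
      obtain ⟨k, hk⟩ := hx
      exact ⟨-k, by rw [inner_neg_left, hk]; push_cast; ring⟩
  have hR1 : ∀ β ∈ T.R, coroot β ∈ T'.R := fun β hβ => by rw [hR, coroot_coroot]; exact hβ
  have hR2 : ∀ β ∈ T'.R, coroot β ∈ T.R := fun β hβ => (hR β).1 hβ
  apply Lat.orbits_le (T.lat hW) (T'.lat hW') hc0
  · exact aux T T' hR1
  · intro x hx y hy
    obtain ⟨k, hk⟩ := aux T' T hR2 y hy x hx
    exact ⟨k, by rw [real_inner_comm, hk, hc]⟩
  · intro x _ h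
    apply T.mem_N_of_dual
    intro y hy
    apply h
    intro β hβ
    have := hy _ (hR2 β hβ)
    rwa [coroot_coroot] at this

namespace Setup
variable (S : Setup V)

lemma ne_zero' {α : V} (h : α ∈ S.R0) : α ≠ 0 := fun h' => S.zero_not_mem (h' ▸ h)

lemma ip_pos {α : V} (h : α ∈ S.R0) : 0 < ⟪α, α⟫ := real_inner_self_pos.mpr (S.ne_zero' h)

lemma neg_mem' {α : V} (h : α ∈ S.R0) : -α ∈ S.R0 := by
  have := S.refl_mem α h α h
  rw [coroot_inner_self (S.ne_zero' h), two_smul] at this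
  simpa using this

lemma pos_or' {α : V} (h : α ∈ S.R0) : α ∈ S.Rpos ∨ -α ∈ S.Rpos := by
  by_cases h' : -α ∈ S.Rpos
  · exact Or.inr h'
  · exact Or.inl ((S.pos_partition α h).2 h')

lemma span_simple : ⊤ ≤ Submodule.span ℝ (Set.range S.simple) := by
  have hp : ∀ α ∈ S.Rpos, α ∈ Submodule.span ℝ (Set.range S.simple) := by
    intro α hα
    obtain ⟨f, hf⟩ := S.pos_decomp α hα
    rw [hf]
    exact Submodule.sum_mem _ fun j _ => Submodule.smul_mem _ _
      (Submodule.subset_span ⟨j, rfl⟩)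
  rw [← S.span_top, Submodule.span_le]
  intro α hα
  rcases S.pos_or' hα with h | h
  · exact hp α h
  · have := Submodule.neg_mem _ (hp _ h)
    rwa [neg_neg] at this

/-- The basis of simple roots. -/
def bas : Module.Basis (Fin S.n) ℝ V :=
  basisOfTopLeSpanOfCardEqFinrank S.simple S.span_simple (by simp [S.hdim])

lemma bas_apply (j) : S.bas j = S.simple j := by simp [bas]

/-- Nonnegative coordinates. -/
def nn (x : V) : Prop := ∀ j, 0 ≤ S.bas.repr x j

lemma nn_sum {x : V} (h : ∃ f : Fin S.n → ℕ, x = ∑ j, (f j : ℝ) • S.simple j) : S.nn x := by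
  obtain ⟨f, rfl⟩ := h
  intro j
  have : ∑ j, (f j : ℝ) • S.simple j = ∑ j, (f j : ℝ) • S.bas j := by simp [bas_apply]
  rw [this, Module.Basis.repr_sum_self]
  positivity

lemma nn_add {x y : V} (hx : S.nn x) (hy : S.nn y) : S.nn (x + y) := by
  intro j
  rw [map_add, Finsupp.add_apply]
  exact add_nonneg (hx j) (hy j)

lemma nn_smul {x : V} {r : ℝ} (hr : 0 ≤ r) (hx : S.nn x) : S.nn (r • x) := by
  intro j
  rw [map_smul, Finsupp.smul_apply, smul_eq_mul]
  exact mul_nonneg hr (hx j)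

lemma nn_pos {α : V} (h : α ∈ S.Rpos) : S.nn α := S.nn_sum (S.pos_decomp α h)

/-- The root system itself. -/
def T2 : RSys V where
  n := S.n
  R := S.R0
  Rp := S.Rpos
  b := S.bas
  hi := S.hroot
  zero_not_mem := S.zero_not_mem
  span_top := S.span_top
  cryst := S.cryst
  refl_mem := S.refl_mem
  reduced := S.reduced
  pos_sub := fun _ h => S.pos_subset h
  pos_or := fun _ h => S.pos_or' h
  simple_mem := fun j => by rw [bas_apply]; exact S.simple_mem j
  pos_nonneg := fun _ h => S.nn_pos h
  hi_mem := S.hroot_mem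
  hi_nonneg := fun β h => S.nn_sum (S.hroot_highest β h)
  c := S.c
  c_pos := by have := S.c_gt; omega

lemma short_refl {α β : V} (hα : α ≠ 0) :
    ⟪β - ⟪β, coroot α⟫ • α, β - ⟪β, coroot α⟫ • α⟫ = ⟪β, β⟫ := by
  rw [← refl_apply', (refl α).inner_map_map]

lemma exists_short {β : V} (hβ : β ∈ S.R0) :
    ∃ γ ∈ S.R0, ⟪γ, γ⟫ = ⟪S.hs, S.hs⟫ ∧ 0 < ⟪γ, β⟫ := by
  have hsR := S.pos_subset S.hs_mem
  by_contra hcon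
  have hperp : ∀ γ ∈ S.R0, ⟪γ, γ⟫ = ⟪S.hs, S.hs⟫ → ⟪γ, β⟫ = 0 := by
    intro γ hγ hn
    by_contra hne
    rcases lt_or_gt_of_ne hne with h | h
    · exact hcon ⟨-γ, S.neg_mem' hγ, by simpa using hn, by simpa using h⟩
    · exact hcon ⟨γ, hγ, hn, h⟩
  apply S.irred
  refine ⟨{β | β ∈ S.R0 ∧ ∀ γ ∈ S.R0, ⟪γ, γ⟫ = ⟪S.hs, S.hs⟫ → ⟪γ, β⟫ = 0},
    {β | β ∈ S.R0 ∧ ¬ ∀ γ ∈ S.R0, ⟪γ, γ⟫ = ⟪S.hs, S.hs⟫ → ⟪γ, β⟫ = 0},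
    ⟨β, hβ, hperp⟩, ⟨S.hs, hsR, fun h => (S.ip_pos hsR).ne' (h _ hsR rfl)⟩, ?_, ?_⟩
  · ext x
    simp only [Set.mem_union, Set.mem_ofPred_eq, Finset.mem_coe]
    tauto
  · rintro α ⟨hα, hαp⟩ δ ⟨hδ, hδp⟩
    push Not at hδp
    obtain ⟨γ, hγ, hn, hne⟩ := hδp
    have h1 := hαp _ (S.refl_mem δ hδ γ hγ) (by rw [short_refl (S.ne_zero' hδ), hn])
    rw [inner_sub_left, hαp γ hγ hn, real_inner_smul_left, coroot, real_inner_smul_right] at h1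
    have h2 := (S.ip_pos hδ).ne'
    have h3 : 2 / ⟪δ, δ⟫ * ⟪γ, δ⟫ * ⟪δ, α⟫ = 0 := by linarith
    have h4 : 2 / ⟪δ, δ⟫ * ⟪γ, δ⟫ ≠ 0 := mul_ne_zero (div_ne_zero two_ne_zero h2) hne
    rw [real_inner_comm]
    exact (mul_eq_zero.1 h3).resolve_left h4

lemma exists_split {β : V} (hβ : β ∈ S.R0) (hlt : ⟪S.hs, S.hs⟫ < ⟪β, β⟫) :
    2 * ⟪S.hs, S.hs⟫ ≤ ⟪β, β⟫ ∧ ∃ γ ∈ S.R0, ⟪γ, γ⟫ = ⟪S.hs, S.hs⟫ ∧ β - γ ∈ S.R0 ∧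
      ⟪β - γ, β - γ⟫ = ⟪S.hs, S.hs⟫ := by
  obtain ⟨γ, hγ, hn, hpos⟩ := S.exists_short hβ
  obtain ⟨p, hp⟩ := S.cryst β hβ γ hγ
  obtain ⟨q, hq⟩ := S.cryst γ hγ β hβ
  have hs0 := S.ip_pos hγ
  have hb0 := S.ip_pos hβ
  rw [← hn] at hlt ⊢
  have hp' : 2 * ⟪γ, β⟫ = p * ⟪β, β⟫ := by
    rw [coroot, real_inner_smul_right] at hp
    rw [← hp]
    field_simp
  have hq' : 2 * ⟪γ, β⟫ = q * ⟪γ, γ⟫ := by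
    rw [coroot, real_inner_smul_right, real_inner_comm γ β] at hq
    rw [← hq]
    field_simp
  have hp0 : 0 < p := by
    have : (0:ℝ) < p := by
      by_contra h
      push Not at h
      nlinarith
    exact_mod_cast this
  have hqp : p < q := by
    have : (p:ℝ) < q := by
      by_contra h
      push Not at h
      have : (0:ℝ) < p := by exact_mod_cast hp0
      nlinarith
    exact_mod_cast this
  have hcs := real_inner_mul_inner_self_le γ β
  have hpq : p * q ≤ 4 := by
    have : (p * q : ℝ) ≤ 4 := by
      by_contra h
      push Not at h
      have h1 : 0 < ⟪γ, γ⟫ * ⟪β, β⟫ := mul_pos hs0 hb0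
      have h2 : (p * q : ℝ) * (⟪γ, γ⟫ * ⟪β, β⟫) = 4 * (⟪γ, β⟫ * ⟪γ, β⟫) := by
        calc (p * q : ℝ) * (⟪γ, γ⟫ * ⟪β, β⟫) = (p * ⟪β, β⟫) * (q * ⟪γ, γ⟫) := by ring
          _ = _ := by rw [← hp', ← hq']; ring
      nlinarith
    exact_mod_cast this
  have hp1 : p = 1 := by
    by_contra hne
    have : 2 ≤ p := by omega
    have : 3 ≤ q := by omega
    nlinarith
  subst hp1
  have hq2 : (2:ℝ) ≤ q := by exact_mod_cast (by omega : 2 ≤ q)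
  rw [Int.cast_one, one_mul] at hp'
  refine ⟨by nlinarith, γ, hγ, rfl, ?_, ?_⟩
  · have h := S.neg_mem' (S.refl_mem β hβ γ hγ)
    rw [hp, Int.cast_one, one_smul, neg_sub] at h
    exact h
  · rw [inner_sub_left, inner_sub_right, inner_sub_right, real_inner_comm γ β]
    linarith

lemma coroot_hs_highest {β : V} (hβ : β ∈ S.R0) : S.nn (coroot S.hs - coroot β) := by
  have hs0 := S.ip_pos (S.pos_subset S.hs_mem)
  have hb0 := S.ip_pos hβ
  rcases S.pos_or' hβ with h | h
  · rcases (S.hs_short β hβ).eq_or_lt with he | hlt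
    · have h1 := S.nn_smul (r := 2 / ⟪S.hs, S.hs⟫) (by positivity)
        (S.nn_sum (S.hs_highest β hβ he.symm))
      rw [smul_sub] at h1
      rw [coroot, coroot, ← he]
      exact h1
    · obtain ⟨h2, γ, hγ, hn, hγ', hn'⟩ := S.exists_split hβ hlt
      have e : coroot S.hs - coroot β = (1 / ⟪S.hs, S.hs⟫) • ((S.hs - γ) + (S.hs - (β - γ)))
          + (1 / ⟪S.hs, S.hs⟫ - 2 / ⟪β, β⟫) • β := by
        simp only [coroot]
        module
      rw [e]
      refine S.nn_add (S.nn_smul (by positivity) (S.nn_add (S.nn_sum (S.hs_highest _ hγ hn))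
        (S.nn_sum (S.hs_highest _ hγ' hn')))) (S.nn_smul ?_ (S.nn_pos h))
      rw [sub_nonneg, div_le_div_iff₀ hb0 hs0]
      linarith
  · have e : coroot S.hs - coroot β = (2 / ⟪S.hs, S.hs⟫) • S.hs + (2 / ⟪β, β⟫) • (-β) := by
      simp only [coroot]
      module
    rw [e]
    exact S.nn_add (S.nn_smul (by positivity) (S.nn_pos S.hs_mem))
      (S.nn_smul (by positivity) (S.nn_pos h))

lemma unit_aux (j) : IsUnit (2 / ⟪S.simple j, S.simple j⟫) := by
  have := S.ip_pos (S.pos_subset (S.simple_mem j))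
  exact IsUnit.mk0 _ (by positivity)

/-- The basis of simple coroots. -/
def bas' : Module.Basis (Fin S.n) ℝ V := S.bas.isUnitSMul S.unit_aux

lemma bas'_apply (j) : S.bas' j = coroot (S.simple j) := by
  rw [bas', Module.Basis.isUnitSMul_apply, bas_apply, coroot]

lemma nn' {x : V} (h : S.nn x) (j) : 0 ≤ S.bas'.repr x j := by
  have h0 := S.ip_pos (S.pos_subset (S.simple_mem j))
  rw [bas', Module.Basis.repr_isUnitSMul, Units.smul_def, smul_eq_mul, Units.val_inv_eq_inv_val,
    IsUnit.unit_spec]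
  exact mul_nonneg (by positivity) (h j)

lemma coroot_inj {α β : V} (h : coroot α = coroot β) : α = β := by
  rw [← coroot_coroot α, h, coroot_coroot]

lemma mem_image_coroot (X : Finset V) (β : V) : β ∈ X.image coroot ↔ coroot β ∈ X := by
  rw [Finset.mem_image]
  constructor
  · rintro ⟨γ, h, rfl⟩
    rwa [coroot_coroot]
  · intro h
    exact ⟨_, h, coroot_coroot β⟩

/-- The dual root system. -/
def T1 : RSys V where
  n := S.n
  R := S.R0.image coroot
  Rp := S.Rpos.image coroot
  b := S.bas'
  hi := coroot S.hs
  zero_not_mem := by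
    rw [mem_image_coroot]
    simpa [coroot] using S.zero_not_mem
  span_top := by
    rw [eq_top_iff, ← S.span_top, Submodule.span_le]
    intro β hβ
    have h1 : coroot β ∈ Submodule.span ℝ ((S.R0.image coroot : Finset V) : Set V) :=
      Submodule.subset_span (Finset.mem_coe.2 (Finset.mem_image_of_mem _ hβ))
    have h2 := Submodule.smul_mem _ (2 / ⟪coroot β, coroot β⟫) h1
    have h3 : (2 / ⟪coroot β, coroot β⟫) • coroot β = β := coroot_coroot β
    rw [h3] at h2
    exact h2
  cryst := by
    intro α hα β hβ
    rw [mem_image_coroot] at hα hβ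
    obtain ⟨k, hk⟩ := S.cryst _ hβ _ hα
    rw [coroot_coroot, real_inner_comm] at hk
    exact ⟨k, hk⟩
  refl_mem := by
    intro α hα β hβ
    rw [mem_image_coroot] at hα hβ ⊢
    rw [RSys.coroot_refl]
    have := S.refl_mem _ hα _ hβ
    rw [coroot_coroot, real_inner_comm] at this
    exact this
  reduced := by
    intro α hα r hr
    rw [mem_image_coroot] at hα hr
    rw [coroot_smul] at hr
    rcases S.reduced _ hα _ hr with h | h
    · left; exact inv_eq_one.1 h
    · right; rw [← inv_inv r, h]; norm_num
  pos_sub := fun α h => by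
    rw [mem_image_coroot] at h ⊢
    exact S.pos_subset h
  pos_or := fun α h => by
    rw [mem_image_coroot] at h ⊢
    rw [mem_image_coroot, coroot_neg]
    exact S.pos_or' h
  simple_mem := fun j => by
    rw [bas'_apply]
    exact Finset.mem_image_of_mem _ (S.simple_mem j)
  pos_nonneg := fun α h => by
    obtain ⟨β, hβ, rfl⟩ := Finset.mem_image.1 h
    have := S.ip_pos (S.pos_subset hβ)
    exact S.nn' (S.nn_smul (by positivity) (S.nn_pos hβ))
  hi_mem := Finset.mem_image_of_mem _ S.hs_mem
  hi_nonneg := fun α h => by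
    obtain ⟨β, hβ, rfl⟩ := Finset.mem_image.1 h
    exact S.nn' (S.coroot_hs_highest hβ)
  c := S.c
  c_pos := by have := S.c_gt; omega

lemma WG_dual : WG S.T2.R = WG S.T1.R := by
  have : {w | ∃ α ∈ S.T2.R, w = refl α} = {w | ∃ α ∈ S.T1.R, w = refl α} := by
    ext w
    constructor
    · rintro ⟨α, hα, rfl⟩
      exact ⟨coroot α, Finset.mem_image_of_mem _ hα, (refl_coroot α).symm⟩
    · rintro ⟨α, hα, rfl⟩
      exact ⟨coroot α, (mem_image_coroot _ _).1 hα, (refl_coroot α).symm⟩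
  rw [WG, WG, this]

lemma card_dual : Nat.card {x | x ∈ S.T1.L ∧ x ∈ S.T1.A} = Nat.card {x | x ∈ S.T2.L ∧ x ∈ S.T2.A} := by
  apply le_antisymm
  · refine RSys.orbits_le S.T1 S.T2 rfl ?_ S.WG_dual rfl
    intro β
    change β ∈ S.R0 ↔ coroot β ∈ S.R0.image coroot
    rw [mem_image_coroot, coroot_coroot]
  · exact RSys.orbits_le S.T2 S.T1 rfl (mem_image_coroot _) rfl S.WG_dual

lemma mem_T1_L {x : V} : x ∈ S.T1.L ↔ x ∈ S.Plat := by
  rw [RSys.mem_L]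
  exact Finset.forall_mem_image

end Setup

/-- the finite sets `P_c` and `P̂_c` have the same cardinality. -/
theorem statement12 (S : Setup V) :
    S.Pc.Finite ∧ S.Phatc.Finite ∧ Nat.card ↥S.Pc = Nat.card ↥S.Phatc := by
  rcases S.admissible with ⟨hh, -⟩ | ⟨hh, -⟩
  · have e1 : S.Pc = {x | x ∈ S.T1.L ∧ x ∈ S.T1.A} := by
      ext x
      simp only [Setup.Pc, Set.mem_ofPred_eq, S.mem_T1_L, RSys.mem_A, Setup.Alc, hh]
      refine and_congr_right fun _ => ?_
      change _ ↔ ∀ β ∈ S.Rpos.image coroot, 0 ≤ ⟪x, β⟫ ∧ ⟪x, β⟫ ≤ (S.c : ℝ)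
      rw [Finset.forall_mem_image]
    have e2 : S.Phatc = {x | x ∈ S.T2.L ∧ x ∈ S.T2.A} := by
      ext x
      simp only [Setup.Phatc, Setup.Phat, Set.mem_ofPred_eq, RSys.mem_L, RSys.mem_A, hh,
        coroot_coroot]
      exact Iff.rfl
    rw [e1, e2]
    exact ⟨S.T1.finite_alcove, S.T2.finite_alcove, S.card_dual⟩
  · set u : ℝ := 2 / ⟪S.hroot, S.hroot⟫ with hu
    have hu0 : 0 < u := by
      have := S.ip_pos (S.pos_subset S.hroot_mem)
      positivity
    have hc0 : (0:ℝ) < S.c := by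
      have := S.c_gt
      exact_mod_cast (by omega : 0 < S.c)
    have hs0 := S.ip_pos (S.pos_subset S.hs_mem)
    have hfin : S.Pc.Finite := by
      apply S.T1.finite_of_bdd _ (fun x hx => S.mem_T1_L.2 hx.1) (2 / ⟪S.hs, S.hs⟫ * (S.c / u))
      rintro x ⟨-, hx⟩
      have hx' : ∀ β ∈ S.R0, |⟪x, β⟫| ≤ S.c / u := by
        have aux : ∀ β ∈ S.Rpos, |⟪x, β⟫| ≤ S.c / u := by
          intro β hβ
          obtain ⟨h1, h2⟩ := hx β hβ
          rw [hh, real_inner_smul_right] at h1 h2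
          rw [abs_of_nonneg (nonneg_of_mul_nonneg_right h1 hu0), le_div_iff₀ hu0, mul_comm]
          exact h2
        intro β hβ
        rcases S.pos_or' hβ with h | h
        · exact aux β h
        · have := aux _ h
          rwa [inner_neg_right, abs_neg] at this
      change ∀ β ∈ S.R0.image coroot, |⟪x, β⟫| ≤ 2 / ⟪S.hs, S.hs⟫ * (S.c / u)
      rw [Finset.forall_mem_image]
      intro β hβ
      have hb0 := S.ip_pos hβ
      rw [coroot, real_inner_smul_right, abs_mul, abs_of_pos (by positivity)]
      refine mul_le_mul ?_ (hx' β hβ) (abs_nonneg _) (by positivity)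
      exact div_le_div_of_nonneg_left (by norm_num) hs0 (S.hs_short β hβ)
    have himg : S.Phatc = (fun x : V => u • x) '' S.Pc := by
      ext y
      simp only [Setup.Phatc, Setup.Phat, Setup.Pc, Setup.Plat, Setup.Alc, Set.mem_ofPred_eq,
        Set.mem_image, hh, coroot_smul, real_inner_smul_right]
      constructor
      · rintro ⟨h1, h2⟩
        refine ⟨u⁻¹ • y, ⟨?_, ?_⟩, smul_inv_smul₀ hu0.ne' y⟩
        · simpa only [real_inner_smul_left] using h1
        · simpa only [real_inner_smul_left, mul_inv_cancel_left₀ hu0.ne'] using h2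
      · rintro ⟨x, ⟨h1, h2⟩, rfl⟩
        constructor
        · simpa only [real_inner_smul_left, inv_mul_cancel_left₀ hu0.ne'] using h1
        · simpa only [real_inner_smul_left] using h2
    have hinj : Function.Injective (fun x : V => u • x) := smul_right_injective V hu0.ne'
    refine ⟨hfin, himg ▸ hfin.image _, ?_⟩
    rw [himg, Nat.card_image_of_injective hinj]

end AffinePieri
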